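/- Let f ∈ 𝓒. The function θ ↦ Z(f,θ) := sup_{μ ∈ 𝓜} { θ μ[f] − D(μ||u) } is convex and differentiable on ℝ, with derivative Z'(f,θ) = μ_{f,θ}[f] = lim_{n→∞} (1/n)(d/dθ)Z_n(f,θ), and Z'(f,·) is continuous and strictly increasing on ℝ. -/

import Mathlib

open MeasureTheory Filter Topology
open scoped ENNReal

noncomputable section

/-- The unit square `[0,1]²` in `ℝ × ℝ`. -/
def unitSq : Set (ℝ × ℝ) := Set.Icc 0 1 ×ˢ Set.Icc 0 1

/-- Lebesgue measure restricted to `[0,1]`. -/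
def unif01 : Measure ℝ := volume.restrict (Set.Icc 0 1)

/-- Lebesgue (uniform) measure on the unit square. -/
def usq : Measure (ℝ × ℝ) := unif01.prod unif01

/-- `𝓜`: Borel probability measures on `[0,1]²` with both marginals Lebesgue on `[0,1]`. -/
def MM : Set (Measure (ℝ × ℝ)) :=
  {μ | IsProbabilityMeasure μ ∧ μ.map Prod.fst = unif01 ∧ μ.map Prod.snd = unif01}

/-- The class `𝓒` of continuous functions on the unit square, not identically zero,
with all row and column integrals vanishing. -/
def memC (f : ℝ × ℝ → ℝ) : Prop :=
  ContinuousOn f unitSq ∧ (∃ p ∈ unitSq, f p ≠ 0) ∧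
    (∀ x ∈ Set.Icc (0 : ℝ) 1, (∫ z in (0 : ℝ)..1, f (x, z)) = 0) ∧
    (∀ y ∈ Set.Icc (0 : ℝ) 1, (∫ z in (0 : ℝ)..1, f (z, y)) = 0)

open scoped Classical in
/-- Kullback–Leibler divergence `D(μ‖ν)`, equal to `∫ log(dμ/dν) dμ` when `μ ≪ ν`
(and this integral exists), and `+∞` otherwise. -/
def KL (μ ν : Measure (ℝ × ℝ)) : ℝ≥0∞ :=
  if μ ≪ ν ∧ Integrable (fun x => Real.log ((μ.rnDeriv ν x).toReal)) μ then
    ENNReal.ofReal (∫ x, Real.log ((μ.rnDeriv ν x).toReal) ∂μ)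
  else ⊤

/-- The objective `θ μ[f] − D(μ‖u)`, as an extended real. -/
def objE (f : ℝ × ℝ → ℝ) (θ : ℝ) (μ : Measure (ℝ × ℝ)) : EReal :=
  ((θ * ∫ p, f p ∂μ : ℝ) : EReal) - (KL μ usq : EReal)

/-- `∑_{i=1}^n f(i/n, π(i)/n)`. -/
def permStat (f : ℝ × ℝ → ℝ) (n : ℕ) (π : Equiv.Perm (Fin n)) : ℝ :=
  ∑ i : Fin n, f ((i.1 + 1 : ℝ) / n, ((π i).1 + 1 : ℝ) / n)

/-- The log normalizing constant `Z_n(f,θ)`. -/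
def Zn (f : ℝ × ℝ → ℝ) (θ : ℝ) (n : ℕ) : ℝ :=
  Real.log (∑ π : Equiv.Perm (Fin n), Real.exp (θ * permStat f n π))

open scoped Classical in
/-- The probability that a sample from `Q_{n,f,θ}` satisfies `p`. -/
def Qprob (f : ℝ × ℝ → ℝ) (θ : ℝ) (n : ℕ) (p : Equiv.Perm (Fin n) → Prop) : ℝ :=
  ∑ π : Equiv.Perm (Fin n), if p π then Real.exp (θ * permStat f n π - Zn f θ n) else 0


/-- The column integral `∫₀¹ exp (G (x, y) + a x) dx`. -/
def colInt (G : ℝ × ℝ → ℝ) (a : ℝ → ℝ) (y : ℝ) : ℝ :=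
  ∫ x in (0 : ℝ)..1, Real.exp (G (x, y) + a x)

lemma continuous_colInt {G : ℝ × ℝ → ℝ} {a : ℝ → ℝ} (hG : Continuous G) (ha : Continuous a) :
    Continuous (colInt G a) := by
  unfold colInt
  apply intervalIntegral.continuous_parametric_intervalIntegral_of_continuous'
  simp only [Function.uncurry_def]
  fun_prop

lemma colInt_mono {G H : ℝ × ℝ → ℝ} {a b : ℝ → ℝ} {c y z : ℝ} (hG : Continuous G)
    (hH : Continuous H) (ha : Continuous a) (hb : Continuous b)
    (h : ∀ x, G (x, y) + a x ≤ H (x, z) + b x + c) :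
    colInt G a y ≤ Real.exp c * colInt H b z := by
  unfold colInt
  rw [← intervalIntegral.integral_const_mul]
  apply intervalIntegral.integral_mono_on zero_le_one
  · exact Continuous.intervalIntegrable (by fun_prop) _ _
  · exact Continuous.intervalIntegrable (by fun_prop) _ _
  · intro x _
    rw [← Real.exp_add]
    exact Real.exp_le_exp.2 (by linarith [h x])

lemma colInt_zero_zero (y : ℝ) : colInt 0 0 y = 1 := by
  simp [colInt]

lemma colInt_pos {G : ℝ × ℝ → ℝ} {a : ℝ → ℝ} (hG : Continuous G) (ha : Continuous a) (y : ℝ) :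
    0 < colInt G a y := by
  unfold colInt
  apply intervalIntegral.intervalIntegral_pos_of_pos
  · exact Continuous.intervalIntegrable (by fun_prop) _ _
  · intro x; positivity
  · exact zero_lt_one

lemma abs_log_colInt_le {G : ℝ × ℝ → ℝ} {a : ℝ → ℝ} (hG : Continuous G) (ha : Continuous a)
    {M N : ℝ} (hM : ∀ p, |G p| ≤ M) (hN : ∀ x, |a x| ≤ N) (y : ℝ) :
    |Real.log (colInt G a y)| ≤ M + N := by
  have hpos := colInt_pos hG ha y
  have h1 : colInt G a y ≤ Real.exp (M + N) * colInt 0 0 y :=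
    colInt_mono hG continuous_zero ha continuous_zero fun x => by
      simp only [Pi.zero_apply]
      linarith [(abs_le.1 (hM (x, y))).2, (abs_le.1 (hN x)).2]
  have h2 : colInt 0 0 y ≤ Real.exp (M + N) * colInt G a y :=
    colInt_mono continuous_zero hG continuous_zero ha fun x => by
      simp only [Pi.zero_apply]
      linarith [(abs_le.1 (hM (x, y))).1, (abs_le.1 (hN x)).1]
  rw [colInt_zero_zero] at h1 h2
  rw [abs_le]
  constructor
  · have := Real.log_le_log zero_lt_one h2
    rw [Real.log_mul (Real.exp_ne_zero _) hpos.ne', Real.log_exp, Real.log_one] at this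
    linarith
  · have := Real.log_le_log hpos h1
    rwa [mul_one, Real.log_exp] at this

/-- Passing from `a` to `log ∘ colInt G a` contracts oscillations of differences. -/
lemma log_colInt_osc {G : ℝ × ℝ → ℝ} (hG : Continuous G) {M : ℝ} (hM : ∀ p, |G p| ≤ M)
    {a a' : ℝ → ℝ} (ha : Continuous a) (ha' : Continuous a') {m d : ℝ}
    (hm : ∀ x, m ≤ a x - a' x) (hd : ∀ x, a x - a' x ≤ m + d) (y y' : ℝ) :
    (Real.log (colInt G a y') - Real.log (colInt G a' y')) -
      (Real.log (colInt G a y) - Real.log (colInt G a' y)) ≤ (1 - Real.exp (-(4 * M))) * d := by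
  have hK := colInt_pos hG ha y
  have hK' := colInt_pos hG ha y'
  have hJ := colInt_pos hG ha' y
  have hJ' := colInt_pos hG ha' y'
  set K := colInt G a y with hKd
  set K' := colInt G a y' with hKd'
  set J := colInt G a' y with hJd
  set J' := colInt G a' y' with hJd'
  set κ := Real.exp (-(4 * M)) with hκ
  have hκ1 : κ ≤ 1 := by
    rw [hκ, Real.exp_le_one_iff]
    linarith [(abs_nonneg _).trans (hM 0)]
  have hκ0 : 0 < κ := Real.exp_pos _
  have hJJ : J ≤ Real.exp (2 * M) * J' := colInt_mono hG hG ha' ha' fun x => by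
    linarith [(abs_le.1 (hM (x, y))).2, (abs_le.1 (hM (x, y'))).1]
  have key : κ * J * (K' - Real.exp m * J') ≤ J' * (K - Real.exp m * J) := by
    have e1 : ∀ z, colInt G a z - Real.exp m * colInt G a' z =
        ∫ x in (0 : ℝ)..1, Real.exp (G (x, z) + a' x) *
          (Real.exp (a x - a' x) - Real.exp m) := by
      intro z
      unfold colInt
      rw [← intervalIntegral.integral_const_mul, ← intervalIntegral.integral_sub]
      · congr 1; ext x
        rw [mul_sub, ← Real.exp_add, ← Real.exp_add, ← Real.exp_add]; ring_nf
      · exact Continuous.intervalIntegrable (by fun_prop) _ _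
      · exact Continuous.intervalIntegrable (by fun_prop) _ _
    rw [hKd, hKd', hJd', hJd, e1 y, e1 y', ← hJd, ← hJd', ← intervalIntegral.integral_const_mul,
      ← intervalIntegral.integral_const_mul]
    apply intervalIntegral.integral_mono_on zero_le_one
    · exact Continuous.intervalIntegrable (by fun_prop) _ _
    · exact Continuous.intervalIntegrable (by fun_prop) _ _
    · intro x _
      rw [← mul_assoc, ← mul_assoc]
      apply mul_le_mul_of_nonneg_right _ (sub_nonneg.2 (Real.exp_le_exp.2 (hm x)))
      have h1 : κ * J ≤ Real.exp (-(2 * M)) * J' := by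
        have : κ * J ≤ κ * (Real.exp (2 * M) * J') := by gcongr
        rwa [← mul_assoc, hκ, ← Real.exp_add, show -(4 * M) + 2 * M = -(2 * M) by ring] at this
      calc κ * J * Real.exp (G (x, y') + a' x)
          ≤ Real.exp (-(2 * M)) * J' * Real.exp (G (x, y') + a' x) := by gcongr
        _ = J' * Real.exp (-(2 * M) + (G (x, y') + a' x)) := by rw [Real.exp_add (-(2 * M))]; ring
        _ ≤ J' * Real.exp (G (x, y) + a' x) := by
          refine mul_le_mul_of_nonneg_left (Real.exp_le_exp.2 ?_) hJ'.le
          linarith [(abs_le.1 (hM (x, y))).1, (abs_le.1 (hM (x, y'))).2]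
  set v := Real.log K' - Real.log J' with hv
  have hvK : K' = Real.exp v * J' := by
    rw [hv, Real.exp_sub, Real.exp_log hK', Real.exp_log hJ']; field_simp
  have hv2 : v ≤ m + d := by
    have : K' ≤ Real.exp (m + d) * J' := colInt_mono hG hG ha ha' fun x => by linarith [hd x]
    rw [hvK] at this
    exact Real.exp_le_exp.1 (le_of_mul_le_mul_right this hJ')
  have hconv : Real.exp (κ * v + (1 - κ) * m) ≤ κ * Real.exp v + (1 - κ) * Real.exp m := by
    have := convexOn_exp.2 (Set.mem_univ v) (Set.mem_univ m) hκ0.le (sub_nonneg.2 hκ1) (by ring)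
    simpa using this
  have h3 : Real.exp (κ * v + (1 - κ) * m) * J ≤ K := by
    rw [hvK] at key
    have : J' * ((κ * Real.exp v + (1 - κ) * Real.exp m) * J) ≤ J' * K := by linarith
    exact (mul_le_mul_of_nonneg_right hconv hJ.le).trans (le_of_mul_le_mul_left this hJ')
  have h4 := Real.log_le_log (by positivity) h3
  rw [Real.log_mul (Real.exp_ne_zero _) hJ.ne', Real.log_exp] at h4
  nlinarith

/-- One half-step of the Sinkhorn iteration. -/
def sinkhornStep (G : C(ℝ × ℝ, ℝ)) (M : ℝ) (hM : ∀ p, |G p| ≤ M)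
    (a : BoundedContinuousFunction ℝ ℝ) : BoundedContinuousFunction ℝ ℝ :=
  BoundedContinuousFunction.ofNormedAddCommGroup (fun y => -Real.log (colInt G a y))
    ((continuous_colInt G.continuous a.continuous).log
      fun y => (colInt_pos G.continuous a.continuous y).ne').neg (M + ‖a‖) fun y => by
    rw [norm_neg, Real.norm_eq_abs]
    exact abs_log_colInt_le G.continuous a.continuous hM (fun x => a.norm_coe_le_norm x) y

/-- All increments of `a - b` are at most `d`. -/
def OscLE (a b : BoundedContinuousFunction ℝ ℝ) (d : ℝ) : Prop :=
  ∀ x x', (a x - b x) - (a x' - b x') ≤ d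

lemma OscLE.sinkhornStep {G : C(ℝ × ℝ, ℝ)} {M : ℝ} (hM : ∀ p, |G p| ≤ M)
    {a b : BoundedContinuousFunction ℝ ℝ} {d : ℝ} (h : OscLE a b d) :
    OscLE (sinkhornStep G M hM a) (sinkhornStep G M hM b) ((1 - Real.exp (-(4 * M))) * d) := by
  intro y y'
  have hb : BddBelow (Set.range fun x => a x - b x) := by
    refine ⟨-‖a - b‖, ?_⟩
    rintro _ ⟨x, rfl⟩
    exact (abs_le.1 ((a - b).norm_coe_le_norm x)).1
  have := log_colInt_osc G.continuous hM a.continuous b.continuous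
    (m := ⨅ x, (a x - b x)) (d := d) (fun x => ciInf_le hb x)
    (fun x => by
      have : a x - b x - d ≤ ⨅ x, (a x - b x) := le_ciInf fun x' => by linarith [h x x']
      linarith) y y'
  change (-Real.log _ - -Real.log _) - (-Real.log _ - -Real.log _) ≤ _
  linarith

/-- Sinkhorn scaling: a bounded continuous kernel `exp F` can be rescaled by functions of each
coordinate so that both marginals on the unit square are uniform. -/
lemma exists_schrodinger_potentials {F : ℝ × ℝ → ℝ} (hF : Continuous F) {M : ℝ}
    (hM : ∀ p, |F p| ≤ M) :
    ∃ a b : ℝ → ℝ, Continuous a ∧ Continuous b ∧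
      (∀ x, ∫ y in (0 : ℝ)..1, Real.exp (F (x, y) + a x + b y) = 1) ∧
      (∀ y, ∫ x in (0 : ℝ)..1, Real.exp (F (x, y) + a x + b y) = 1) := by
  let G : C(ℝ × ℝ, ℝ) := ⟨F, hF⟩
  let G' : C(ℝ × ℝ, ℝ) := ⟨fun p => F (p.2, p.1), by fun_prop⟩
  have hG : ∀ p, |G p| ≤ M := hM
  have hG' : ∀ p, |G' p| ≤ M := fun p => hM _
  let T : BoundedContinuousFunction ℝ ℝ → BoundedContinuousFunction ℝ ℝ :=
    fun a => sinkhornStep G' M hG' (sinkhornStep G M hG a)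
  let T₀ : BoundedContinuousFunction ℝ ℝ → BoundedContinuousFunction ℝ ℝ :=
    fun a => T a - BoundedContinuousFunction.const ℝ (T a 0)
  set q := 1 - Real.exp (-(4 * M)) with hq
  have hq0 : 0 ≤ q := by
    rw [hq, sub_nonneg, Real.exp_le_one_iff]
    linarith [(abs_nonneg _).trans (hM 0)]
  have hq1 : q < 1 := by rw [hq]; linarith [Real.exp_pos (-(4 * M))]
  have hosc : ∀ a b d, 0 ≤ d → OscLE a b d → OscLE (T₀ a) (T₀ b) (q * d) := by
    intro a b d hd h x x'
    have h1 := (h.sinkhornStep hG).sinkhornStep hG' x x'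
    change ((T a x - T a 0) - (T b x - T b 0)) - ((T a x' - T a 0) - (T b x' - T b 0)) ≤ _
    change (T a x - T b x) - (T a x' - T b x') ≤ q * (q * d) at h1
    have : q * (q * d) ≤ 1 * (q * d) := by gcongr
    linarith
  have hiter : ∀ n a b d, 0 ≤ d → OscLE a b d → OscLE (T₀^[n] a) (T₀^[n] b) (q ^ n * d) := by
    intro n
    induction n with
    | zero => intro a b d _ h; simpa using h
    | succ n ih =>
      intro a b d hd h
      rw [Function.iterate_succ_apply', Function.iterate_succ_apply', pow_succ', mul_assoc]
      exact hosc _ _ _ (by positivity) (ih a b d hd h)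
  obtain ⟨n, hn⟩ := exists_pow_lt_of_lt_one (show (0 : ℝ) < 1 / 4 by norm_num) hq1
  have hcontr : ContractingWith (1 / 2) (T₀^[n + 1]) := by
    refine ⟨by norm_num, LipschitzWith.of_dist_le_mul fun a b => ?_⟩
    have hab : OscLE a b (2 * dist a b) := by
      intro x x'
      have h1 := abs_le.1 ((a - b).norm_coe_le_norm x)
      have h2 := abs_le.1 ((a - b).norm_coe_le_norm x')
      rw [← dist_eq_norm] at h1 h2
      simp only [BoundedContinuousFunction.coe_sub, Pi.sub_apply] at h1 h2
      linarith [h1.2, h2.1]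
    have h := hiter (n + 1) a b _ (by positivity) hab
    have hz : ∀ c, (T₀^[n + 1] c) 0 = 0 := by
      intro c
      rw [Function.iterate_succ_apply']
      exact sub_self _
    have hqn : q ^ (n + 1) * (2 * dist a b) ≤ 1 / 2 * dist a b := by
      have : q ^ (n + 1) ≤ 1 / 4 := by
        rw [pow_succ]
        nlinarith [pow_nonneg hq0 n]
      nlinarith [dist_nonneg (x := a) (y := b)]
    rw [BoundedContinuousFunction.dist_le (by positivity)]
    intro x
    rw [Real.dist_eq, abs_le]
    have e1 := h x 0
    have e2 := h 0 x
    rw [hz, hz] at e1 e2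
    simp only [NNReal.coe_div, NNReal.coe_one, NNReal.coe_ofNat]
    constructor <;> linarith
  have hfix := hcontr.isFixedPt_fixedPoint_iterate
  set a := ContractingWith.fixedPoint (T₀^[n + 1]) hcontr with ha
  set b := sinkhornStep G M hG a with hb
  have hcol : ∀ y, ∫ x in (0 : ℝ)..1, Real.exp (F (x, y) + a x + b y) = 1 := by
    intro y
    have hp := colInt_pos G.continuous a.continuous y
    have hby : b y = -Real.log (colInt G a y) := rfl
    have : ∀ x, Real.exp (F (x, y) + a x + b y) =
        (colInt G a y)⁻¹ * Real.exp (G (x, y) + a x) := by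
      intro x
      rw [Real.exp_add, hby, Real.exp_neg, Real.exp_log hp, mul_comm]; rfl
    simp_rw [this]
    rw [intervalIntegral.integral_const_mul]
    exact inv_mul_cancel₀ hp.ne'
  have hrow : ∀ x, ∫ y in (0 : ℝ)..1, Real.exp (F (x, y) + a x + b y) =
      Real.exp (-(T a 0)) := by
    intro x
    have hp := colInt_pos G'.continuous b.continuous x
    have hTx : T a x = -Real.log (colInt G' b x) := rfl
    have hax : a x = T a x - T a 0 := by
      conv_lhs => rw [← hfix.eq]
      rfl
    have : ∀ y, Real.exp (F (x, y) + a x + b y) =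
        Real.exp (-(T a 0)) * (colInt G' b x)⁻¹ * Real.exp (G' (y, x) + b y) := by
      intro y
      have : (colInt G' b x)⁻¹ = Real.exp (T a x) := by
        rw [hTx, Real.exp_neg, Real.exp_log hp]
      rw [this, ← Real.exp_add, ← Real.exp_add, hax]
      change Real.exp _ = Real.exp (_ + (F (x, y) + b y))
      ring_nf
    simp_rw [this]
    rw [intervalIntegral.integral_const_mul, mul_assoc]
    change _ * ((colInt G' b x)⁻¹ * colInt G' b x) = _
    rw [inv_mul_cancel₀ hp.ne', mul_one]
  have hc : Real.exp (-(T a 0)) = 1 := by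
    have hswap := intervalIntegral_intervalIntegral_swap (a := (0 : ℝ)) (b := 1) (c := 0) (d := 1)
      (F := fun x y => Real.exp (F (x, y) + a x + b y)) (by
        have hc : Continuous (Function.uncurry fun x y => Real.exp (F (x, y) + a x + b y)) := by
          simp only [Function.uncurry_def]; fun_prop
        exact (hc.continuousOn.integrableOn_compact
          (isCompact_uIcc.prod isCompact_uIcc)).mono_set
            (Set.prod_mono Set.uIoc_subset_uIcc Set.uIoc_subset_uIcc))
    simp only [hrow, hcol] at hswap
    simpa using hswap
  exact ⟨a, b, a.continuous, b.continuous, fun x => (hrow x).trans hc, hcol⟩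
lemma isCompact_unitSq : IsCompact unitSq := isCompact_Icc.prod isCompact_Icc

instance : IsProbabilityMeasure unif01 := ⟨by simp [unif01]⟩

instance : IsProbabilityMeasure usq := by unfold usq; infer_instance

lemma integral_unif01 (a : ℝ → ℝ) : ∫ x, a x ∂unif01 = ∫ x in (0 : ℝ)..1, a x := by
  rw [unif01, intervalIntegral.integral_of_le zero_le_one, integral_Icc_eq_integral_Ioc]

lemma ae_mem_unitSq {μ : Measure (ℝ × ℝ)} (hμ : μ ∈ MM) : ∀ᵐ p ∂μ, p ∈ unitSq := by
  obtain ⟨_, h1, h2⟩ := hμ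
  have hI : ∀ᵐ x ∂unif01, x ∈ Set.Icc (0 : ℝ) 1 := ae_restrict_mem measurableSet_Icc
  have e1 : ∀ᵐ p ∂μ, p.1 ∈ Set.Icc (0 : ℝ) 1 :=
    ae_of_ae_map measurable_fst.aemeasurable (h1 ▸ hI)
  have e2 : ∀ᵐ p ∂μ, p.2 ∈ Set.Icc (0 : ℝ) 1 :=
    ae_of_ae_map measurable_snd.aemeasurable (h2 ▸ hI)
  filter_upwards [e1, e2] with p h h' using ⟨h, h'⟩

lemma usq_mem_MM : usq ∈ MM := by
  refine ⟨inferInstance, ?_, ?_⟩ <;> simp [usq, Measure.map_fst_prod, Measure.map_snd_prod]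

lemma Continuous.integrable_of_mem_MM {μ : Measure (ℝ × ℝ)} (hμ : μ ∈ MM) {h : ℝ × ℝ → ℝ}
    (hh : Continuous h) : Integrable h μ := by
  have := hμ.1
  have e : IntegrableOn h unitSq μ := hh.continuousOn.integrableOn_compact isCompact_unitSq
  rwa [IntegrableOn, Measure.restrict_eq_self_of_ae_mem (ae_mem_unitSq hμ)] at e

lemma integral_fst_of_mem_MM {μ : Measure (ℝ × ℝ)} (hμ : μ ∈ MM) {a : ℝ → ℝ} (ha : Continuous a) :
    ∫ p, a p.1 ∂μ = ∫ x in (0 : ℝ)..1, a x := by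
  rw [← integral_unif01, ← hμ.2.1, integral_map measurable_fst.aemeasurable
    ha.aestronglyMeasurable]

lemma integral_snd_of_mem_MM {μ : Measure (ℝ × ℝ)} (hμ : μ ∈ MM) {b : ℝ → ℝ} (hb : Continuous b) :
    ∫ p, b p.2 ∂μ = ∫ y in (0 : ℝ)..1, b y := by
  rw [← integral_unif01, ← hμ.2.2, integral_map measurable_snd.aemeasurable
    hb.aestronglyMeasurable]

lemma integral_usq {h : ℝ × ℝ → ℝ} (hh : Continuous h) :
    ∫ p, h p ∂usq = ∫ x in (0 : ℝ)..1, ∫ y in (0 : ℝ)..1, h (x, y) := by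
  have := hh.integrable_of_mem_MM usq_mem_MM
  rw [usq] at this ⊢
  rw [integral_prod _ this, integral_unif01]
  simp_rw [integral_unif01]

lemma integral_congr_of_mem_MM {μ : Measure (ℝ × ℝ)} (hμ : μ ∈ MM) {f F : ℝ × ℝ → ℝ}
    (hfF : Set.EqOn f F unitSq) : ∫ p, f p ∂μ = ∫ p, F p ∂μ :=
  integral_congr_ae ((ae_mem_unitSq hμ).mono fun _ hp => hfF hp)

lemma integral_add_potentials {μ : Measure (ℝ × ℝ)} (hμ : μ ∈ MM) {F : ℝ × ℝ → ℝ} {a b : ℝ → ℝ}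
    (hF : Continuous F) (ha : Continuous a) (hb : Continuous b) :
    ∫ p, (F p + a p.1 + b p.2) ∂μ =
      ∫ p, F p ∂μ + (∫ x in (0 : ℝ)..1, a x) + ∫ y in (0 : ℝ)..1, b y := by
  rw [← integral_fst_of_mem_MM hμ ha, ← integral_snd_of_mem_MM hμ hb, integral_add, integral_add]
  all_goals exact Continuous.integrable_of_mem_MM hμ (by fun_prop)

/-- Weak duality: any pair of potentials bounds the objective from above. -/
lemma objE_le_dual {f F : ℝ × ℝ → ℝ} (hF : Continuous F) (hfF : Set.EqOn f F unitSq) {a b : ℝ → ℝ}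
    (ha : Continuous a) (hb : Continuous b) (θ : ℝ) {μ : Measure (ℝ × ℝ)} (hμ : μ ∈ MM) :
    objE f θ μ ≤ ((-(∫ x in (0 : ℝ)..1, a x) - (∫ y in (0 : ℝ)..1, b y) +
      ∫ p, Real.exp (θ * F p + a p.1 + b p.2) ∂usq - 1 : ℝ) : EReal) := by
  have hprob := hμ.1
  unfold objE KL
  split_ifs with h
  · obtain ⟨hac, hint⟩ := h
    set g : ℝ × ℝ → ℝ := fun p => θ * F p + a p.1 + b p.2 with hg
    have hgc : Continuous g := by fun_prop
    have hexp : Integrable (fun p => Real.exp (g p)) usq :=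
      Continuous.integrable_of_mem_MM usq_mem_MM (by fun_prop)
    have hgμ := hgc.integrable_of_mem_MM hμ
    have hpt := isProbabilityMeasure_tilted hexp
    have h1 := integral_llr_tilted_right hac hgμ hexp hint
    have h2 := InformationTheory.integral_llr_add_sub_measure_univ_nonneg
      (hac.trans (absolutelyContinuous_tilted hexp))
      (integrable_llr_tilted_right hac hgμ hint hexp)
    have h3 := Real.log_le_sub_one_of_pos (integral_exp_pos hexp)
    have h4 := integral_add_potentials hμ (F := fun p => θ * F p) (by fun_prop) ha hb
    rw [integral_const_mul] at h4
    simp only [probReal_univ] at h2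
    rw [integral_congr_of_mem_MM hμ hfF, EReal.coe_ennreal_ofReal, ← EReal.coe_sub,
      EReal.coe_le_coe_iff]
    change ∫ x, g x ∂μ = _ at h4
    have h5 : ∫ x, llr μ usq x ∂μ ≤ max (∫ x, Real.log (μ.rnDeriv usq x).toReal ∂μ) 0 :=
      le_max_left _ _
    linarith
  · simp

/-- Continuous potentials making `exp (F + a ⊕ b)` a density with uniform marginals. -/
structure IsPotential (F : ℝ × ℝ → ℝ) (a b : ℝ → ℝ) : Prop where
  left : Continuous a
  right : Continuous b
  row : ∀ x, ∫ y in (0 : ℝ)..1, Real.exp (F (x, y) + a x + b y) = 1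
  col : ∀ y, ∫ x in (0 : ℝ)..1, Real.exp (F (x, y) + a x + b y) = 1

lemma IsPotential.integral_exp {F : ℝ × ℝ → ℝ} (hF : Continuous F) {a b : ℝ → ℝ}
    (h : IsPotential F a b) : ∫ p, Real.exp (F p + a p.1 + b p.2) ∂usq = 1 := by
  have ha := h.left
  have hb := h.right
  rw [integral_usq (by fun_prop)]
  simp [h.row]

/-- The measure with density `exp (F + a ⊕ b)`. -/
def gibbs (F : ℝ × ℝ → ℝ) (a b : ℝ → ℝ) : Measure (ℝ × ℝ) :=
  usq.tilted fun p => F p + a p.1 + b p.2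

lemma IsPotential.gibbs_mem_MM {F : ℝ × ℝ → ℝ} (hF : Continuous F) {a b : ℝ → ℝ}
    (h : IsPotential F a b) : gibbs F a b ∈ MM := by
  have ha := h.left
  have hb := h.right
  have hexp : Integrable (fun p => Real.exp (F p + a p.1 + b p.2)) usq :=
    Continuous.integrable_of_mem_MM usq_mem_MM (by fun_prop)
  have hone : ∀ c : ℝ → ℝ, Continuous c → (∀ y, 0 ≤ c y) → ∫ y in (0 : ℝ)..1, c y = 1 →
      ∫⁻ y, ENNReal.ofReal (c y) ∂unif01 = 1 := by
    intro c hc h0 h1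
    rw [← ofReal_integral_eq_lintegral_ofReal _ (ae_of_all _ h0), integral_unif01, h1,
      ENNReal.ofReal_one]
    exact hc.continuousOn.integrableOn_compact isCompact_Icc
  refine ⟨isProbabilityMeasure_tilted hexp, ?_, ?_⟩
  · ext s hs
    rw [Measure.map_apply measurable_fst hs, gibbs,
      tilted_apply' _ _ (measurable_fst hs), h.integral_exp hF]
    simp_rw [div_one]
    rw [show (Prod.fst ⁻¹' s : Set (ℝ × ℝ)) = s ×ˢ Set.univ by ext; simp, usq,
      ← Measure.prod_restrict, lintegral_prod _ (by fun_prop), Measure.restrict_univ]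
    have hrow : ∀ x, ∫⁻ y, ENNReal.ofReal (Real.exp (F (x, y) + a x + b y)) ∂unif01 = 1 :=
      fun x => hone _ (by fun_prop) (fun y => (Real.exp_pos _).le) (h.row x)
    simp [hrow]
  · ext s hs
    rw [Measure.map_apply measurable_snd hs, gibbs,
      tilted_apply' _ _ (measurable_snd hs), h.integral_exp hF]
    simp_rw [div_one]
    rw [show (Prod.snd ⁻¹' s : Set (ℝ × ℝ)) = Set.univ ×ˢ s by ext; simp, usq,
      ← Measure.prod_restrict, lintegral_prod_symm _ (by fun_prop), Measure.restrict_univ]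
    have hcol : ∀ y, ∫⁻ x, ENNReal.ofReal (Real.exp (F (x, y) + a x + b y)) ∂unif01 = 1 :=
      fun y => hone _ (by fun_prop) (fun x => (Real.exp_pos _).le) (h.col y)
    simp [hcol]

lemma IsPotential.integral_gibbs {F : ℝ × ℝ → ℝ} (hF : Continuous F) {a b : ℝ → ℝ}
    (h : IsPotential F a b) (g : ℝ × ℝ → ℝ) :
    ∫ p, g p ∂(gibbs F a b) = ∫ p, Real.exp (F p + a p.1 + b p.2) * g p ∂usq := by
  rw [gibbs, integral_tilted, h.integral_exp hF]
  simp

/-- The Gibbs measure attains the dual bound. -/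
lemma IsPotential.objE_gibbs {f F : ℝ × ℝ → ℝ} (hF : Continuous F) (hfF : Set.EqOn f F unitSq)
    {θ : ℝ} {a b : ℝ → ℝ} (h : IsPotential (fun p => θ * F p) a b) :
    objE f θ (gibbs (fun p => θ * F p) a b) =
      ((-(∫ x in (0 : ℝ)..1, a x) - (∫ y in (0 : ℝ)..1, b y) : ℝ) : EReal) := by
  have ha := h.left
  have hb := h.right
  have hθF : Continuous fun p => θ * F p := by fun_prop
  have hmem := h.gibbs_mem_MM hθF
  have hprob := hmem.1
  set ν := gibbs (fun p => θ * F p) a b with hν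
  have hexp : Integrable (fun p => Real.exp (θ * F p + a p.1 + b p.2)) usq :=
    Continuous.integrable_of_mem_MM usq_mem_MM (by fun_prop)
  have hac : ν ≪ usq := tilted_absolutelyContinuous _ _
  have hae : (fun p => Real.log (ν.rnDeriv usq p).toReal) =ᵐ[ν]
      fun p => θ * F p + a p.1 + b p.2 := by
    filter_upwards [hac.ae_le (log_rnDeriv_tilted_left_self hexp)] with p hp
    rw [hν, gibbs, hp, h.integral_exp hθF, Real.log_one, sub_zero]
  have hint : Integrable (fun p => Real.log (ν.rnDeriv usq p).toReal) ν :=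
    (integrable_congr hae).2 (Continuous.integrable_of_mem_MM hmem (by fun_prop))
  have hval : ∫ p, Real.log (ν.rnDeriv usq p).toReal ∂ν =
      θ * ∫ p, f p ∂ν + (∫ x in (0 : ℝ)..1, a x) + ∫ y in (0 : ℝ)..1, b y := by
    rw [integral_congr_ae hae, integral_add_potentials hmem hθF ha hb, integral_const_mul,
      integral_congr_of_mem_MM hmem hfF]
  have hnn := InformationTheory.integral_llr_add_sub_measure_univ_nonneg hac hint
  simp only [probReal_univ, llr_def, add_sub_cancel_right] at hnn
  unfold objE KL
  rw [if_pos ⟨hac, hint⟩, EReal.coe_ennreal_ofReal, max_eq_left hnn, ← EReal.coe_sub, hval]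
  congr 1
  ring

/-- The value of the dual problem at a pair of potentials. -/
def dualVal (a b : ℝ → ℝ) : ℝ := -(∫ x in (0 : ℝ)..1, a x) - ∫ y in (0 : ℝ)..1, b y

/-- The mean of `F` under the density `exp (θ F + a ⊕ b)`. -/
def gibbsMean (F : ℝ × ℝ → ℝ) (θ : ℝ) (a b : ℝ → ℝ) : ℝ :=
  ∫ p, Real.exp (θ * F p + a p.1 + b p.2) * F p ∂usq

lemma eqOn_unitSq_of_integral_eq_zero {φ : ℝ × ℝ → ℝ} (hφ : Continuous φ) (h0 : ∀ p, 0 ≤ φ p)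
    (hint : ∫ p, φ p ∂usq = 0) : ∀ p ∈ unitSq, φ p = 0 := by
  have hae := (integral_eq_zero_iff_of_nonneg h0 (hφ.integrable_of_mem_MM usq_mem_MM)).1 hint
  have husq : usq = volume.restrict unitSq := by
    rw [usq, unif01, Measure.prod_restrict]; rfl
  rw [husq] at hae
  refine Measure.eqOn_of_ae_eq hae hφ.continuousOn continuousOn_const ?_
  rw [unitSq, interior_prod_eq, closure_prod_eq, interior_Icc, closure_Ioo zero_ne_one]

/-- A function with vanishing row and column means which splits additively vanishes. -/
lemma eq_zero_of_eq_add {F : ℝ × ℝ → ℝ} {u v : ℝ → ℝ} (hu : Continuous u) (hv : Continuous v)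
    (h : ∀ p ∈ unitSq, F p = u p.1 + v p.2)
    (hrow : ∀ x ∈ Set.Icc (0 : ℝ) 1, (∫ z in (0 : ℝ)..1, F (x, z)) = 0)
    (hcol : ∀ y ∈ Set.Icc (0 : ℝ) 1, (∫ z in (0 : ℝ)..1, F (z, y)) = 0) :
    ∀ p ∈ unitSq, F p = 0 := by
  have hu' : ∀ x ∈ Set.Icc (0 : ℝ) 1, u x + ∫ y in (0 : ℝ)..1, v y = 0 := by
    intro x hx
    refine Eq.trans (Eq.symm ?_) (hrow x hx)
    rw [intervalIntegral.integral_congr (g := fun z => u x + v z),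
      intervalIntegral.integral_add (by simp) (hv.intervalIntegrable _ _)]
    · simp
    · intro z hz
      rw [Set.uIcc_of_le zero_le_one] at hz
      exact h _ ⟨hx, hz⟩
  have hv' : ∀ y ∈ Set.Icc (0 : ℝ) 1, (∫ x in (0 : ℝ)..1, u x) + v y = 0 := by
    intro y hy
    refine Eq.trans (Eq.symm ?_) (hcol y hy)
    rw [intervalIntegral.integral_congr (g := fun z => u z + v y),
      intervalIntegral.integral_add (hu.intervalIntegrable _ _) (by simp)]
    · simp
    · intro z hz
      rw [Set.uIcc_of_le zero_le_one] at hz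
      exact h _ ⟨hz, hy⟩
  have huv : (∫ x in (0 : ℝ)..1, u x) + ∫ y in (0 : ℝ)..1, v y = 0 := by
    rw [intervalIntegral.integral_congr (g := fun _ => -∫ y in (0 : ℝ)..1, v y)]
    · simp
    · intro z hz
      rw [Set.uIcc_of_le zero_le_one] at hz
      simpa using eq_neg_of_add_eq_zero_left (hu' z hz)
  intro p hp
  rw [h p hp]
  linarith [hu' _ hp.1, hv' _ hp.2]

lemma IsPotential.integral_exp_mul {F : ℝ × ℝ → ℝ} (hF : Continuous F) {a b : ℝ → ℝ}
    {θ : ℝ} (h : IsPotential (fun p => θ * F p) a b) (t : ℝ) {a' b' : ℝ → ℝ}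
    (ha' : Continuous a') (hb' : Continuous b') :
    ∫ p, Real.exp (θ * F p + a p.1 + b p.2) * (t * F p + a' p.1 + b' p.2) ∂usq =
      t * gibbsMean F θ a b - dualVal a' b' := by
  have hθF : Continuous fun p => θ * F p := by fun_prop
  rw [← h.integral_gibbs hθF, integral_add_potentials (F := fun p => t * F p)
    (h.gibbs_mem_MM hθF) (by fun_prop) ha' hb', integral_const_mul, h.integral_gibbs hθF,
    dualVal, gibbsMean]
  ring

/-- `gibbsMean` is a strict subgradient of the dual value. -/
lemma dualVal_lt {F : ℝ × ℝ → ℝ} (hF : Continuous F)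
    (hrow : ∀ x ∈ Set.Icc (0 : ℝ) 1, (∫ z in (0 : ℝ)..1, F (x, z)) = 0)
    (hcol : ∀ y ∈ Set.Icc (0 : ℝ) 1, (∫ z in (0 : ℝ)..1, F (z, y)) = 0)
    (hne : ∃ p ∈ unitSq, F p ≠ 0) {θ t : ℝ} (hθ : θ ≠ t) {a b a' b' : ℝ → ℝ}
    (h : IsPotential (fun p => θ * F p) a b) (h' : IsPotential (fun p => t * F p) a' b') :
    dualVal a b + (t - θ) * gibbsMean F θ a b < dualVal a' b' := by
  have ha := h.left
  have hb := h.right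
  have ha' := h'.left
  have hb' := h'.right
  set g : ℝ × ℝ → ℝ := fun p => θ * F p + a p.1 + b p.2 with hg
  set g' : ℝ × ℝ → ℝ := fun p => t * F p + a' p.1 + b' p.2 with hg'
  have hgc : Continuous g := by fun_prop
  have hgc' : Continuous g' := by fun_prop
  set φ : ℝ × ℝ → ℝ := fun p =>
    Real.exp (g p) * g p - Real.exp (g p) * g' p - Real.exp (g p) + Real.exp (g' p) with hφ
  have hφc : Continuous φ := by fun_prop
  have hφe : ∀ p, φ p = Real.exp (g p) * (Real.exp (g' p - g p) - (g' p - g p + 1)) := by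
    intro p
    have : Real.exp (g' p) = Real.exp (g p) * Real.exp (g' p - g p) := by
      rw [← Real.exp_add]; ring_nf
    simp only [hφ, this]; ring
  have hφ0 : ∀ p, 0 ≤ φ p := fun p => by
    rw [hφe]
    exact mul_nonneg (Real.exp_pos _).le (sub_nonneg.2 (Real.add_one_le_exp _))
  have hint : ∀ {ψ : ℝ × ℝ → ℝ}, Continuous ψ → Integrable ψ usq :=
    fun hψ => hψ.integrable_of_mem_MM usq_mem_MM
  have hval : ∫ p, φ p ∂usq =
      dualVal a' b' - dualVal a b - (t - θ) * gibbsMean F θ a b := by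
    rw [hφ, integral_add (hint (by fun_prop)) (hint (by fun_prop)),
      integral_sub (hint (by fun_prop)) (hint (by fun_prop)),
      integral_sub (hint (by fun_prop)) (hint (by fun_prop)),
      h.integral_exp_mul hF θ ha hb, h.integral_exp_mul hF t ha' hb',
      h.integral_exp (by fun_prop), h'.integral_exp (by fun_prop)]
    ring
  have hpos : 0 < ∫ p, φ p ∂usq := by
    refine lt_of_le_of_ne (integral_nonneg hφ0) fun h0 => ?_
    have hz := eqOn_unitSq_of_integral_eq_zero hφc hφ0 h0.symm
    obtain ⟨p, hp, hFp⟩ := hne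
    refine hFp (eq_zero_of_eq_add (u := fun x => (a' x - a x) / (θ - t))
      (v := fun y => (b' y - b y) / (θ - t)) (by fun_prop) (by fun_prop) (fun p hp => ?_)
      hrow hcol p hp)
    have hgg : g' p - g p = 0 := by
      by_contra hc
      have := hz p hp
      rw [hφe] at this
      have h2 := Real.add_one_lt_exp hc
      exact absurd this (mul_pos (Real.exp_pos _) (sub_pos.2 h2)).ne'
    have : θ - t ≠ 0 := sub_ne_zero.2 hθ
    simp only [hg, hg'] at hgg
    field_simp
    linarith
  linarith

lemma dualVal_add_le {F : ℝ × ℝ → ℝ} (hF : Continuous F) {M : ℝ} (hM : ∀ p, |F p| ≤ M) {θ s : ℝ}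
    (hs : |s| * M ≤ 1) {a b a' b' : ℝ → ℝ} (h : IsPotential (fun p => θ * F p) a b)
    (h' : IsPotential (fun p => (θ + s) * F p) a' b') :
    dualVal a' b' ≤ dualVal a b + s * gibbsMean F θ a b + M ^ 2 * s ^ 2 := by
  have ha := h.left
  have hb := h.right
  have hint : ∀ {ψ : ℝ × ℝ → ℝ}, Continuous ψ → Integrable ψ usq :=
    fun hψ => hψ.integrable_of_mem_MM usq_mem_MM
  have h1 := objE_le_dual (f := F) hF (fun _ _ => rfl) ha hb (θ + s)
    (h'.gibbs_mem_MM (by fun_prop))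
  rw [h'.objE_gibbs hF (fun _ _ => rfl), EReal.coe_le_coe_iff] at h1
  have h2 : ∫ p, Real.exp ((θ + s) * F p + a p.1 + b p.2) ∂usq ≤
      ∫ p, ((1 + M ^ 2 * s ^ 2) * Real.exp (θ * F p + a p.1 + b p.2) +
        s * (Real.exp (θ * F p + a p.1 + b p.2) * F p)) ∂usq := by
    refine integral_mono (hint (by fun_prop)) (hint (by fun_prop)) fun p => ?_
    have hsF : |s * F p| ≤ 1 := by
      rw [abs_mul]
      exact (mul_le_mul_of_nonneg_left (hM p) (abs_nonneg s)).trans hs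
    have h3 := (abs_le.1 (Real.abs_exp_sub_one_sub_id_le hsF)).2
    have h4 : (s * F p) ^ 2 ≤ M ^ 2 * s ^ 2 := by
      rw [mul_pow, mul_comm]
      have : F p ^ 2 ≤ M ^ 2 := sq_le_sq' (abs_le.1 (hM p)).1 (abs_le.1 (hM p)).2
      gcongr
    calc Real.exp ((θ + s) * F p + a p.1 + b p.2)
        = Real.exp (θ * F p + a p.1 + b p.2) * Real.exp (s * F p) := by
          rw [← Real.exp_add]; ring_nf
      _ ≤ Real.exp (θ * F p + a p.1 + b p.2) * (1 + s * F p + M ^ 2 * s ^ 2) := by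
          gcongr; linarith
      _ = _ := by ring
  rw [integral_add (hint (by fun_prop)) (hint (by fun_prop)), integral_const_mul,
    integral_const_mul, h.integral_exp (by fun_prop)] at h2
  simp only [dualVal, gibbsMean] at h1 ⊢
  linarith

section RealFunctions

variable {V c : ℝ → ℝ}

lemma convexOn_of_subgradient (hsub : ∀ θ t, V θ + (t - θ) * c θ ≤ V t) :
    ConvexOn ℝ Set.univ V := by
  refine ⟨convex_univ, fun x _ y _ p q hp hq hpq => ?_⟩
  have h1 := hsub (p • x + q • y) x
  have h2 := hsub (p • x + q • y) y
  simp only [smul_eq_mul] at *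
  have h3 := add_le_add (mul_le_mul_of_nonneg_left h1 hp) (mul_le_mul_of_nonneg_left h2 hq)
  have : p = 1 - q := by linarith
  subst this
  nlinarith

lemma hasDerivAt_of_subgradient (hsub : ∀ θ t, V θ + (t - θ) * c θ ≤ V t) {r K : ℝ} (hr : 0 < r)
    (hup : ∀ θ s, |s| ≤ r → V (θ + s) ≤ V θ + s * c θ + K * s ^ 2) (θ : ℝ) :
    HasDerivAt V (c θ) θ := by
  rw [hasDerivAt_iff_isLittleO_nhds_zero]
  have hO : (fun s => V (θ + s) - V θ - s • c θ) =O[𝓝 0] fun s => s ^ 2 := by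
    refine Asymptotics.IsBigO.of_bound K ?_
    have : ∀ᶠ s : ℝ in 𝓝 0, |s| ≤ r := by
      filter_upwards [Metric.closedBall_mem_nhds (0 : ℝ) hr] with s hs
      simpa using hs
    filter_upwards [this] with s hs
    have h1 := hsub θ (θ + s)
    have h2 := hup θ s hs
    rw [Real.norm_eq_abs, Real.norm_eq_abs, abs_of_nonneg (sq_nonneg s), smul_eq_mul,
      abs_of_nonneg] <;> linarith
  refine hO.trans_isLittleO ?_
  simpa using Asymptotics.isLittleO_pow_pow (𝕜 := ℝ) (show 1 < 2 by norm_num)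

lemma continuous_of_subgradient (hsub : ∀ θ t, V θ + (t - θ) * c θ ≤ V t) {r K : ℝ} (hr : 0 < r)
    (hup : ∀ θ s, |s| ≤ r → V (θ + s) ≤ V θ + s * c θ + K * s ^ 2) : Continuous c := by
  rw [continuous_iff_continuousAt]
  intro θ
  have hbound : ∀ s, |s| ≤ r / 2 → |c (θ + s) - c θ| ≤ 4 * K * |s| := by
    intro s hs
    rcases eq_or_ne s 0 with rfl | hs0
    · simp
    have hspos := abs_pos.2 hs0
    have h1 := hsub (θ + s) (θ + (s + s))
    have h2 := hup θ (s + s) (by rw [← two_mul, abs_mul, abs_two]; linarith)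
    have h3 := hsub (θ + s) θ
    have h4 := hsub θ (θ + s)
    have h5 : s * (c (θ + s) - c θ) ≤ 4 * K * (|s| * |s|) := by
      rw [abs_mul_abs_self]; nlinarith
    have h6 : 0 ≤ s * (c (θ + s) - c θ) := by nlinarith
    have h7 : |s| * |c (θ + s) - c θ| ≤ |s| * (4 * K * |s|) := by
      rw [← abs_mul, abs_of_nonneg h6]; linarith
    exact le_of_mul_le_mul_left h7 hspos
  rw [ContinuousAt, tendsto_iff_dist_tendsto_zero]
  refine squeeze_zero' (.of_forall fun _ => dist_nonneg) (g := fun t => 4 * K * |t - θ|) ?_ ?_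
  · filter_upwards [Metric.closedBall_mem_nhds θ (half_pos hr)] with t ht
    rw [Metric.mem_closedBall, Real.dist_eq] at ht
    have := hbound (t - θ) ht
    rwa [add_sub_cancel, ← Real.dist_eq] at this
  · have : Continuous fun t => 4 * K * |t - θ| := by fun_prop
    simpa using this.tendsto θ

lemma strictMono_of_subgradient (hsub : ∀ θ t, θ ≠ t → V θ + (t - θ) * c θ < V t) :
    StrictMono c := by
  intro x y hxy
  have h1 := hsub x y hxy.ne
  have h2 := hsub y x hxy.ne'
  nlinarith

lemma eq_of_subgradient_of_hasDerivAt {θ m d : ℝ} (hsub : ∀ t, V θ + (t - θ) * m ≤ V t)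
    (hd : HasDerivAt V d θ) : m = d := by
  have h1 : HasDerivAt (fun t => V t - (t - θ) * m) (d - 1 * m) θ :=
    hd.sub (((hasDerivAt_id θ).sub_const θ).mul_const m)
  have hmin : IsLocalMin (fun t => V t - (t - θ) * m) θ :=
    .of_forall fun t => by simpa using by linarith [hsub t]
  linarith [hmin.hasDerivAt_eq_zero h1]

/-- Pointwise limits of functions with subgradients: the subgradients converge wherever the limit
is differentiable. -/
lemma tendsto_subgradient {W D : ℕ → ℝ → ℝ} {θ d : ℝ}
    (hsub : ∀ n t, W n θ + (t - θ) * D n θ ≤ W n t)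
    (hlim : ∀ t, Tendsto (fun n => W n t) atTop (𝓝 (V t))) (hd : HasDerivAt V d θ) :
    Tendsto (fun n => D n θ) atTop (𝓝 d) := by
  have hslope := hasDerivAt_iff_tendsto_slope.1 hd
  have hlim' : ∀ t, Tendsto (fun n => slope (W n) θ t) atTop (𝓝 (slope V θ t)) := fun t => by
    simp only [slope_def_field]
    exact ((hlim t).sub (hlim θ)).div_const _
  rw [tendsto_order]
  constructor
  · intro l hl
    have h1 := (hslope.mono_left (nhdsWithin_mono (s := Set.Iio θ) θ fun t ht => ne_of_lt ht)).eventually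
      (lt_mem_nhds hl)
    obtain ⟨t, ht, htθ⟩ := (h1.and self_mem_nhdsWithin).exists
    filter_upwards [(hlim' t).eventually (lt_mem_nhds ht)] with n hn
    refine hn.trans_le ?_
    rw [slope_def_field, div_le_iff_of_neg (sub_neg.2 htθ)]
    linarith [hsub n t]
  · intro u hu
    have h1 := (hslope.mono_left (nhdsWithin_mono (s := Set.Ioi θ) θ fun t ht => ne_of_gt ht)).eventually
      (gt_mem_nhds hu)
    obtain ⟨t, ht, htθ⟩ := (h1.and self_mem_nhdsWithin).exists
    filter_upwards [(hlim' t).eventually (gt_mem_nhds ht)] with n hn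
    refine lt_of_le_of_lt ?_ hn
    rw [slope_def_field, le_div_iff₀ (sub_pos.2 htθ)]
    linarith [hsub n t]

end RealFunctions

lemma hasDerivAt_Zn (f : ℝ × ℝ → ℝ) (θ : ℝ) (n : ℕ) :
    HasDerivAt (fun t => Zn f t n)
      ((∑ π : Equiv.Perm (Fin n), Real.exp (θ * permStat f n π) * permStat f n π) /
        ∑ π : Equiv.Perm (Fin n), Real.exp (θ * permStat f n π)) θ := by
  refine HasDerivAt.log ?_ (Finset.sum_pos (fun _ _ => Real.exp_pos _) Finset.univ_nonempty).ne'
  refine HasDerivAt.fun_sum fun π _ => ?_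
  simpa using ((hasDerivAt_id θ).mul_const (permStat f n π)).exp

lemma Zn_subgradient (f : ℝ × ℝ → ℝ) (θ t : ℝ) (n : ℕ) :
    Zn f θ n + (t - θ) * deriv (fun t => Zn f t n) θ ≤ Zn f t n := by
  have hpos : ∀ t, 0 < ∑ π : Equiv.Perm (Fin n), Real.exp (t * permStat f n π) :=
    fun t => Finset.sum_pos (fun _ _ => Real.exp_pos _) Finset.univ_nonempty
  have hd := (hasDerivAt_Zn f θ n).deriv
  set m := deriv (fun t => Zn f t n) θ with hm
  rw [eq_div_iff (hpos θ).ne'] at hd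
  unfold Zn
  rw [← Real.log_exp ((t - θ) * m), ← Real.log_mul (hpos θ).ne' (Real.exp_ne_zero _)]
  refine Real.log_le_log (mul_pos (hpos θ) (Real.exp_pos _)) ?_
  have h1 : ∀ π : Equiv.Perm (Fin n),
      Real.exp ((t - θ) * m) * (Real.exp (θ * permStat f n π) * (1 + (t - θ) *
        (permStat f n π - m))) ≤ Real.exp (t * permStat f n π) := by
    intro π
    have h2 := Real.add_one_le_exp ((t - θ) * (permStat f n π - m))
    calc _ ≤ Real.exp ((t - θ) * m) * (Real.exp (θ * permStat f n π) *
          Real.exp ((t - θ) * (permStat f n π - m))) := by gcongr; linarith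
      _ = _ := by rw [← Real.exp_add, ← Real.exp_add]; ring_nf
  refine le_trans (le_of_eq ?_) (Finset.sum_le_sum fun π _ => h1 π)
  rw [← Finset.mul_sum, mul_comm]
  congr 1
  have : ∀ π : Equiv.Perm (Fin n), Real.exp (θ * permStat f n π) *
      (1 + (t - θ) * (permStat f n π - m)) = (1 - (t - θ) * m) * Real.exp (θ * permStat f n π) +
        (t - θ) * (Real.exp (θ * permStat f n π) * permStat f n π) := fun π => by ring
  simp_rw [this]
  rw [Finset.sum_add_distrib, ← Finset.mul_sum, ← Finset.mul_sum, ← hd]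
  ring

section Permanents

variable {ι κ : Type*} [Fintype ι] [DecidableEq κ]

/-- The number of points in the fiber of `β` over `b`. -/
def fiberCard (β : ι → κ) (b : κ) : ℕ := (Finset.univ.filter fun i => β i = b).card

lemma fiberCard_comp_perm (β : ι → κ) (π : Equiv.Perm ι) : fiberCard (β ∘ π) = fiberCard β := by
  ext b
  exact Finset.card_equiv π (by simp)

variable [Fintype κ]

lemma sum_fiberCard (β : ι → κ) : ∑ b, fiberCard β b = Fintype.card ι :=
  (Finset.card_eq_sum_card_fiberwise (fun _ _ => Finset.mem_coe.2 (Finset.mem_univ _))).symm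

lemma prod_fiberCard (β : ι → κ) (g : κ → ℝ) : ∏ i, g (β i) = ∏ b, g b ^ fiberCard β b := by
  rw [← Finset.prod_fiberwise' Finset.univ β g]
  simp [fiberCard]

variable [DecidableEq ι]

lemma card_comp_perm_eq {β B : ι → κ} (h : fiberCard B = fiberCard β) :
    (Finset.univ.filter fun π : Equiv.Perm ι => β ∘ π = B).card =
      ∏ b, (fiberCard β b).factorial := by
  have e : ∀ b, Nonempty ({i // B i = b} ≃ {i // β i = b}) := fun b => by
    refine Fintype.card_eq.1 ?_
    simpa [Fintype.card_subtype, fiberCard] using congrFun h b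
  have hπ : β ∘ Equiv.ofFiberEquiv (fun b => (e b).some) = B := by
    ext i
    exact Equiv.ofFiberEquiv_map _ i
  set π₀ := Equiv.ofFiberEquiv (fun b => (e b).some)
  have h1 := DomMulAct.stabilizer_card β
  simp only [Fintype.card_subtype] at h1
  unfold fiberCard
  rw [← h1]
  refine Finset.card_equiv (Equiv.mulRight π₀⁻¹) fun π => ?_
  simp only [Finset.mem_filter, Finset.mem_univ, true_and, Equiv.coe_mulRight, ← hπ]
  constructor
  · intro h2
    ext i
    simpa using congrFun h2 (π₀⁻¹ i)
  · intro h2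
    ext i
    simpa using congrFun h2 (π₀ i)

/-- The permanent of a matrix with constant column blocks, as a sum over block assignments. -/
lemma sum_perm_prod_comp (β : ι → κ) (w : ι → κ → ℝ) :
    ∑ π : Equiv.Perm ι, ∏ i, w i (β (π i)) =
      (∏ b, ((fiberCard β b).factorial : ℝ)) *
        ∑ B : ι → κ with fiberCard B = fiberCard β, ∏ i, w i (B i) := by
  rw [← Finset.sum_fiberwise Finset.univ (fun π : Equiv.Perm ι => β ∘ π), Finset.sum_filter,
    Finset.mul_sum]
  refine Finset.sum_congr rfl fun B _ => ?_
  have : ∀ π ∈ Finset.univ.filter (fun π : Equiv.Perm ι => β ∘ π = B),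
      ∏ i, w i (β (π i)) = ∏ i, w i (B i) := fun π hπ => by
    rw [← (Finset.mem_filter.1 hπ).2]
    rfl
  rw [Finset.sum_congr rfl this, Finset.sum_const, nsmul_eq_mul]
  split_ifs with h
  · rw [card_comp_perm_eq h]
    push_cast
    rfl
  · rw [Finset.filter_false_of_mem]
    · simp
    · rintro π - rfl
      exact h (fiberCard_comp_perm β π)

lemma sum_filter_fiberCard_le {w : ι → κ → ℝ}
    (hw : ∀ i b, 0 ≤ w i b) (m : κ → ℕ) :
    ∑ B : ι → κ with fiberCard B = m, ∏ i, w i (B i) ≤ ∏ i, ∑ b, w i b := by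
  rw [Finset.prod_univ_sum, Fintype.piFinset_univ]
  exact Finset.sum_le_sum_of_subset_of_nonneg (Finset.filter_subset _ _)
    fun _ _ _ => Finset.prod_nonneg fun _ _ => hw _ _

/-- A partial block assignment not exceeding the block sizes extends to one with exactly these
block sizes. -/
lemma exists_fiberCard_eq {m : κ → ℕ} (hm : ∑ b, m b = Fintype.card ι) (B : ι → Option κ)
    (hB : ∀ b, fiberCard B (some b) ≤ m b) :
    ∃ B' : ι → κ, fiberCard B' = m ∧ ∀ i, B i = none ∨ B i = some (B' i) := by
  have hcard : Fintype.card {i // B i = none} =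
      Fintype.card (Σ b, Fin (m b - fiberCard B (some b))) := by
    have h1 := sum_fiberCard B
    rw [Fintype.sum_option] at h1
    have h2 : ∑ b, (m b - fiberCard B (some b)) + ∑ b, fiberCard B (some b) = ∑ b, m b := by
      rw [← Finset.sum_add_distrib]
      exact Finset.sum_congr rfl fun b _ => Nat.sub_add_cancel (hB b)
    have h3 : Fintype.card {i // B i = none} = fiberCard B none := Fintype.card_subtype _
    simp only [Fintype.card_sigma, Fintype.card_fin]
    omega
  obtain ⟨e⟩ := Fintype.card_eq.1 hcard
  let B' : ι → κ := fun i => if h : B i = none then (e ⟨i, h⟩).1 else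
    (B i).get (Option.isSome_iff_ne_none.2 h)
  have hB' : ∀ i, B i = none ∨ B i = some (B' i) := fun i => by
    by_cases h : B i = none
    · exact Or.inl h
    · right
      simp [B', h]
  have hnone : ∀ i (h : B i = none), B' i = (e ⟨i, h⟩).1 := fun i h => by simp [B', h]
  refine ⟨B', ?_, hB'⟩
  ext b
  have hsplit : fiberCard B' b = fiberCard B (some b) +
      (Finset.univ.filter fun i => B i = none ∧ B' i = b).card := by
    unfold fiberCard
    rw [← Finset.card_union_of_disjoint]
    · congr 1
      ext i
      simp only [Finset.mem_filter, Finset.mem_univ, true_and, Finset.mem_union]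
      rcases hB' i with h | h <;> simp [h]
    · rw [Finset.disjoint_filter]
      rintro i - h ⟨h', -⟩
      simp [h] at h'
  have hsnd : (Finset.univ.filter fun i => B i = none ∧ B' i = b).card =
      m b - fiberCard B (some b) := by
    rw [← Fintype.card_subtype, ← Fintype.card_fin (m b - fiberCard B (some b))]
    refine Fintype.card_congr (Equiv.trans ?_ (Equiv.sigmaSubtype (β := fun b => Fin (m b - fiberCard B (some b))) b))
    refine Equiv.trans (Equiv.subtypeSubtypeEquivSubtypeInter _ _).symm ?_
    exact e.subtypeEquiv fun i => by rw [hnone _ i.2]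
  rw [hsplit, hsnd, Nat.add_sub_cancel' (hB b)]

/-- Chernoff's bound for the size of a block under a product weight. -/
lemma sum_prod_lt_fiberCard_le {p : ι → κ → ℝ} (hp : ∀ i b, 0 ≤ p i b) (hp1 : ∀ i, ∑ b, p i b = 1)
    (b : κ) {s r : ℝ} (hs : 0 ≤ s) :
    ∑ B : ι → κ with r ≤ fiberCard B b, ∏ i, p i (B i) ≤
      Real.exp ((Real.exp s - 1) * ∑ i, p i b - s * r) := by
  have h1 : ∀ B : ι → κ, ∏ i, p i (B i) * Real.exp (if B i = b then s else 0) =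
      (∏ i, p i (B i)) * Real.exp (s * fiberCard B b) := fun B => by
    rw [Finset.prod_mul_distrib, ← Real.exp_sum, ← Finset.sum_filter, Finset.sum_const,
      nsmul_eq_mul, mul_comm s]
    rfl
  calc ∑ B : ι → κ with r ≤ fiberCard B b, ∏ i, p i (B i)
      ≤ ∑ B : ι → κ with r ≤ fiberCard B b,
          Real.exp (-(s * r)) * ((∏ i, p i (B i)) * Real.exp (s * fiberCard B b)) := by
        refine Finset.sum_le_sum fun B hB => ?_
        have h2 : 1 ≤ Real.exp (-(s * r) + s * fiberCard B b) :=
          Real.one_le_exp (by nlinarith [(Finset.mem_filter.1 hB).2])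
        rw [Real.exp_add] at h2
        nlinarith [Finset.prod_nonneg fun i (_ : i ∈ Finset.univ) => hp i (B i)]
    _ ≤ ∑ B : ι → κ,
          Real.exp (-(s * r)) * ((∏ i, p i (B i)) * Real.exp (s * fiberCard B b)) := by
        refine Finset.sum_le_sum_of_subset_of_nonneg (Finset.filter_subset _ _) fun B _ _ => ?_
        have := Finset.prod_nonneg fun i (_ : i ∈ Finset.univ) => hp i (B i)
        positivity
    _ = Real.exp (-(s * r)) * ∏ i, ∑ c, p i c * Real.exp (if c = b then s else 0) := by
        rw [← Finset.mul_sum, Finset.prod_univ_sum, Fintype.piFinset_univ]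
        exact congrArg _ (Finset.sum_congr rfl fun B _ => (h1 B).symm)
    _ = Real.exp (-(s * r)) * ∏ i, ((Real.exp s - 1) * p i b + 1) := by
        congr 1
        refine Finset.prod_congr rfl fun i _ => ?_
        have h2 := Finset.add_sum_erase _ (p i) (Finset.mem_univ b)
        rw [hp1 i] at h2
        rw [← Finset.add_sum_erase _ _ (Finset.mem_univ b), if_pos rfl,
          Finset.sum_congr rfl fun c hc => by
            rw [if_neg (Finset.ne_of_mem_erase hc), Real.exp_zero, mul_one]]
        linear_combination h2
    _ ≤ Real.exp (-(s * r)) * ∏ i, Real.exp ((Real.exp s - 1) * p i b) := by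
        have hs1 : 0 ≤ Real.exp s - 1 := sub_nonneg.2 (Real.one_le_exp hs)
        gcongr with i
        · exact fun i _ => add_nonneg (mul_nonneg hs1 (hp i b)) zero_le_one
        · exact Real.add_one_le_exp _
    _ = _ := by
        rw [← Real.exp_sum, ← Finset.mul_sum, ← Real.exp_add]
        ring_nf

/-- A lower bound for the weight of the assignments with prescribed block sizes under a product of
probability weights whose expected block sizes are close to the prescribed ones. -/
lemma half_le_sum_filter_fiberCard {w : ι → κ → ℝ} {τ δ : ℝ} (hτ : 0 < τ) (hδ : 0 < δ) (hδ1 : δ < 1)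
    (hw : ∀ i b, τ ≤ w i b) (hw1 : ∀ i, ∑ b, w i b = 1) {m : κ → ℕ}
    (hm : ∑ b, m b = Fintype.card ι) (hcol : ∀ b, ∑ i, w i b ≤ (1 + δ / 4) * m b)
    (hexp : ∑ b, Real.exp (-(δ ^ 2 / 8) * m b) ≤ 1 / 2) :
    1 / 2 ≤ (1 + δ / τ) ^ Fintype.card ι *
      ∑ B : ι → κ with fiberCard B = m, ∏ i, w i (B i) := by
  have hw0 : ∀ i b, 0 ≤ w i b := fun i b => hτ.le.trans (hw i b)
  let p : ι → Option κ → ℝ := fun i o => o.elim δ fun b => (1 - δ) * w i b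
  have hp : ∀ i o, 0 ≤ p i o := fun i o => by
    cases o
    · exact hδ.le
    · exact mul_nonneg (sub_nonneg.2 hδ1.le) (hw0 _ _)
  have hp1 : ∀ i, ∑ o, p i o = 1 := fun i => by
    simp only [Fintype.sum_option, p, Option.elim, ← Finset.mul_sum, hw1]
    ring
  have hprod : ∀ B : ι → Option κ, 0 ≤ ∏ i, p i (B i) :=
    fun B => Finset.prod_nonneg fun i _ => hp i _
  have htotal : ∑ B : ι → Option κ, ∏ i, p i (B i) = 1 := by
    have := Finset.prod_univ_sum (fun _ : ι => (Finset.univ : Finset (Option κ))) p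
    rw [Fintype.piFinset_univ] at this
    rw [← this]
    simp [hp1]
  have hbad : ∀ b, ∑ B : ι → Option κ with (m b : ℝ) ≤ fiberCard B (some b), ∏ i, p i (B i) ≤
      Real.exp (-(δ ^ 2 / 8) * m b) := fun b => by
    refine (sum_prod_lt_fiberCard_le hp hp1 (some b) (s := δ / 4) (by positivity)).trans
      (Real.exp_le_exp.2 ?_)
    have h1 : Real.exp (δ / 4) - 1 ≤ δ / 4 + (δ / 4) ^ 2 := by
      have := (abs_le.1 (Real.abs_exp_sub_one_sub_id_le (x := δ / 4)
        (by rw [abs_of_pos (by positivity)]; linarith))).2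
      linarith
    have h2 : ∑ i, p i (some b) ≤ (1 - δ) * ((1 + δ / 4) * m b) := by
      simp only [p, Option.elim, ← Finset.mul_sum]
      exact mul_le_mul_of_nonneg_left (hcol b) (sub_nonneg.2 hδ1.le)
    have h3 : 0 ≤ ∑ i, p i (some b) := Finset.sum_nonneg fun i _ => hp i _
    have h4 : (Real.exp (δ / 4) - 1) * ∑ i, p i (some b) ≤
        (δ / 4 + (δ / 4) ^ 2) * ((1 - δ) * ((1 + δ / 4) * m b)) :=
      mul_le_mul h1 h2 h3 (by positivity)
    have h5 : (δ / 4 + (δ / 4) ^ 2) * ((1 - δ) * (1 + δ / 4)) - δ / 4 ≤ -(δ ^ 2 / 8) := by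
      nlinarith [pow_pos hδ 2, pow_pos hδ 3, pow_pos hδ 4]
    nlinarith [mul_le_mul_of_nonneg_right h5 (Nat.cast_nonneg (α := ℝ) (m b))]
  have hgood : ∑ B : ι → Option κ with ∀ b, fiberCard B (some b) ≤ m b, ∏ i, p i (B i) ≤
      ∑ B' : ι → κ with fiberCard B' = m, ∏ i, (δ + (1 - δ) * w i (B' i)) := by
    have h1 : ∀ B' : ι → κ, ∏ i, (δ + (1 - δ) * w i (B' i)) =
        ∑ B : ι → Option κ, if ∀ i, B i = none ∨ B i = some (B' i) then ∏ i, p i (B i) else 0 := by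
      intro B'
      have := Finset.prod_univ_sum (fun i : ι => ({none, some (B' i)} : Finset (Option κ))) p
      rw [← Finset.sum_filter]
      convert this using 2 with i
      · simp [p]
      · ext B
        simp
    simp only [h1]
    rw [Finset.sum_comm, Finset.sum_filter]
    refine Finset.sum_le_sum fun B _ => ?_
    have hnn : ∀ B' : ι → κ, 0 ≤ if ∀ i, B i = none ∨ B i = some (B' i) then ∏ i, p i (B i) else 0 :=
      fun B' => by
        split_ifs
        exacts [hprod B, le_rfl]
    split_ifs with hB
    · obtain ⟨B', hB', hBB'⟩ := exists_fiberCard_eq hm B hB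
      refine le_trans (le_of_eq (if_pos hBB').symm)
        (Finset.single_le_sum (f := fun B' : ι → κ =>
          if ∀ i, B i = none ∨ B i = some (B' i) then ∏ i, p i (B i) else 0)
          (fun B' _ => hnn B') (Finset.mem_filter.2 ⟨Finset.mem_univ _, hB'⟩))
    · exact Finset.sum_nonneg fun B' _ => hnn B'
  have hcover : ∑ B : ι → Option κ, ∏ i, p i (B i) ≤
      ∑ B : ι → Option κ with ∀ b, fiberCard B (some b) ≤ m b, ∏ i, p i (B i) +
        ∑ b, ∑ B : ι → Option κ with (m b : ℝ) ≤ fiberCard B (some b), ∏ i, p i (B i) := by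
    simp only [Finset.sum_filter]
    rw [Finset.sum_comm, ← Finset.sum_add_distrib]
    refine Finset.sum_le_sum fun B _ => ?_
    have hnn : ∀ b, 0 ≤ if (m b : ℝ) ≤ fiberCard B (some b) then ∏ i, p i (B i) else 0 :=
      fun b => by
        split_ifs
        exacts [hprod B, le_rfl]
    split_ifs with hB
    · exact le_add_of_nonneg_right (Finset.sum_nonneg fun b _ => hnn b)
    · push Not at hB
      obtain ⟨b, hb⟩ := hB
      rw [zero_add]
      refine le_trans (le_of_eq (if_pos (by exact_mod_cast hb.le)).symm)
        (Finset.single_le_sum (f := fun b => if (m b : ℝ) ≤ fiberCard B (some b) then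
          ∏ i, p i (B i) else 0) (fun b _ => hnn b) (Finset.mem_univ b))
  have hlast : ∑ B' : ι → κ with fiberCard B' = m, ∏ i, (δ + (1 - δ) * w i (B' i)) ≤
      (1 + δ / τ) ^ Fintype.card ι * ∑ B : ι → κ with fiberCard B = m, ∏ i, w i (B i) := by
    rw [Finset.mul_sum]
    refine Finset.sum_le_sum fun B _ => ?_
    have h0 : (1 + δ / τ) ^ Fintype.card ι = ∏ _i : ι, (1 + δ / τ) := by simp
    rw [h0, ← Finset.prod_mul_distrib]
    refine Finset.prod_le_prod (fun i _ => ?_) fun i _ => ?_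
    · exact add_nonneg hδ.le (mul_nonneg (sub_nonneg.2 hδ1.le) (hw0 _ _))
    · have h1 : δ ≤ δ / τ * w i (B i) := by
        rw [div_mul_eq_mul_div, le_div_iff₀ hτ]
        exact mul_le_mul_of_nonneg_left (hw _ _) hδ.le
      nlinarith [hw0 i (B i)]
  have := Finset.sum_le_sum fun b (_ : b ∈ Finset.univ) => hbad b
  linarith

end Permanents

/-- A crude form of Stirling's formula. -/
lemma abs_log_factorial_sub_le (m : ℕ) :
    0 ≤ Real.log m.factorial - (m * Real.log m - m) ∧
      Real.log m.factorial - (m * Real.log m - m) ≤ 1 + Real.log m := by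
  rcases Nat.eq_zero_or_pos m with rfl | hm
  · simp
  have hm' : (0 : ℝ) < m := by exact_mod_cast hm
  constructor
  · have h := Real.pow_div_factorial_le_exp _ hm'.le m
    have hf : (0 : ℝ) < m.factorial := by exact_mod_cast m.factorial_pos
    have := Real.log_le_log (by positivity) h
    rw [Real.log_exp, Real.log_div (by positivity) hf.ne', Real.log_pow] at this
    linarith
  · clear hm'
    induction m, hm using Nat.le_induction with
    | base => simp
    | succ m hm ih =>
      have hm' : (0 : ℝ) < m := by exact_mod_cast hm
      have h1 : 1 - (m : ℝ) / (m + 1) ≤ Real.log ((m + 1) / m) := by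
        have := Real.one_sub_inv_le_log_of_pos (x := ((m : ℝ) + 1) / m) (by positivity)
        rwa [inv_div] at this
      rw [Real.log_div (by positivity) (by positivity)] at h1
      have h2 : 1 ≤ (m + 1) * (Real.log (m + 1) - Real.log m) := by
        have h3 : 1 - (m : ℝ) / (m + 1) = 1 / (m + 1) := by field_simp; ring
        rw [h3, div_le_iff₀ (by positivity)] at h1
        linarith
      rw [Nat.factorial_succ]
      push_cast
      rw [Real.log_mul (by positivity) (by positivity)]
      nlinarith

section BlockAverages

variable {ι κ : Type*} [Fintype ι] [Fintype κ] [DecidableEq κ]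

/-- The normalized sums of the rows of `A` over the blocks of `β`. -/
def blockWeight (β : ι → κ) (A : ι → ι → ℝ) (i : ι) (b : κ) : ℝ :=
  (∑ j with β j = b, A i j) / Fintype.card ι

lemma sum_blockWeight (β : ι → κ) (A : ι → ι → ℝ) (i : ι) :
    ∑ b, blockWeight β A i b = (∑ j, A i j) / Fintype.card ι := by
  unfold blockWeight
  rw [← Finset.sum_div, Finset.sum_fiberwise]

lemma sum_log_factorial_bounds (β : ι → κ) :
    -(1 + Real.log (Fintype.card ι)) ≤ ∑ b, (Real.log (fiberCard β b).factorial +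
        fiberCard β b * (Real.log (Fintype.card ι) - Real.log (fiberCard β b))) -
        Real.log (Fintype.card ι).factorial ∧
      ∑ b, (Real.log (fiberCard β b).factorial +
        fiberCard β b * (Real.log (Fintype.card ι) - Real.log (fiberCard β b))) -
        Real.log (Fintype.card ι).factorial ≤
      Fintype.card κ * (1 + Real.log (Fintype.card ι)) := by
  set n := Fintype.card ι with hn
  have hsum : ∑ b, (fiberCard β b : ℝ) = n := by exact_mod_cast sum_fiberCard β
  have h1 : ∑ b, (Real.log (fiberCard β b).factorial +
      fiberCard β b * (Real.log n - Real.log (fiberCard β b))) =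
      ∑ b, (Real.log (fiberCard β b).factorial -
        (fiberCard β b * Real.log (fiberCard β b) - fiberCard β b)) + (n * Real.log n - n) := by
    rw [← hsum, Finset.sum_mul, ← Finset.sum_sub_distrib, ← Finset.sum_add_distrib]
    refine Finset.sum_congr rfl fun b _ => ?_
    rw [hsum]
    ring
  have h2 := abs_log_factorial_sub_le n
  have h3 : 0 ≤ ∑ b, (Real.log (fiberCard β b).factorial -
      (fiberCard β b * Real.log (fiberCard β b) - fiberCard β b)) :=
    Finset.sum_nonneg fun b _ => (abs_log_factorial_sub_le _).1
  have h4 : ∑ b, (Real.log (fiberCard β b).factorial -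
      (fiberCard β b * Real.log (fiberCard β b) - fiberCard β b)) ≤
      ∑ _b : κ, (1 + Real.log n) := by
    refine Finset.sum_le_sum fun b _ => (abs_log_factorial_sub_le _).2.trans ?_
    rcases Nat.eq_zero_or_pos (fiberCard β b) with h | h
    · rw [h]
      simp [Real.log_natCast_nonneg]
    · have : fiberCard β b ≤ n := by
        rw [hn, ← sum_fiberCard β]
        exact Finset.single_le_sum (f := fiberCard β) (fun _ _ => Nat.zero_le _) (Finset.mem_univ b)
      gcongr
  rw [Finset.sum_const, nsmul_eq_mul, Finset.card_univ] at h4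
  constructor <;> linarith [h2.1, h2.2]

variable [DecidableEq ι]

/-- The sum over all permutations of the entries' products. -/
def permanent (A : ι → ι → ℝ) : ℝ := ∑ π : Equiv.Perm ι, ∏ i, A i (π i)

/-- The total weight of the block assignments with the block sizes of `β`. -/
def balancedWeight (β : ι → κ) (A : ι → ι → ℝ) : ℝ :=
  ∑ B : ι → κ with fiberCard B = fiberCard β, ∏ i, blockWeight β A i (B i)

lemma permanent_pos {A : ι → ι → ℝ} (hA : ∀ i j, 0 < A i j) : 0 < permanent A :=
  Finset.sum_pos (fun _ _ => Finset.prod_pos fun _ _ => hA _ _) Finset.univ_nonempty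

lemma permanent_le_exp_mul {A B : ι → ι → ℝ} {ε : ℝ} (hA : ∀ i j, 0 < A i j)
    (h : ∀ i j, A i j ≤ Real.exp ε * B i j) :
    permanent A ≤ Real.exp (Fintype.card ι * ε) * permanent B := by
  unfold permanent
  rw [Finset.mul_sum]
  refine Finset.sum_le_sum fun π _ => ?_
  have : Real.exp (Fintype.card ι * ε) = ∏ _i : ι, Real.exp ε := by
    simp [Real.exp_nat_mul]
  rw [this, ← Finset.prod_mul_distrib]
  exact Finset.prod_le_prod (fun i _ => (hA i _).le) fun i _ => h i _

lemma balancedWeight_pos {β : ι → κ} {A : ι → ι → ℝ} (hq : ∀ i b, 0 < blockWeight β A i b) :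
    0 < balancedWeight β A :=
  Finset.sum_pos (fun _ _ => Finset.prod_pos fun _ _ => hq _ _)
    ⟨β, Finset.mem_filter.2 ⟨Finset.mem_univ _, rfl⟩⟩

lemma log_permanent_block (β : ι → κ) {A : ι → ι → ℝ} (hq : ∀ i b, 0 < blockWeight β A i b)
    (hm : ∀ b, 0 < fiberCard β b) :
    Real.log (permanent fun i j =>
        (Fintype.card ι : ℝ) / fiberCard β (β j) * blockWeight β A i (β j)) =
      ∑ b, (Real.log (fiberCard β b).factorial +
        fiberCard β b * (Real.log (Fintype.card ι) - Real.log (fiberCard β b))) +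
      Real.log (balancedWeight β A) := by
  rcases isEmpty_or_nonempty κ with hκ | ⟨⟨b₀⟩⟩
  · have : IsEmpty ι := Function.isEmpty β
    simp [permanent, balancedWeight, Finset.filter_true_of_mem, funext_iff]
  have hn : (0 : ℝ) < Fintype.card ι := by
    rw [← sum_fiberCard β]
    exact_mod_cast Finset.sum_pos (fun b _ => hm b) ⟨b₀, Finset.mem_univ _⟩
  have hm' : ∀ b, (0 : ℝ) < fiberCard β b := fun b => by exact_mod_cast hm b
  have h1 : ∑ B : ι → κ with fiberCard B = fiberCard β,
      ∏ i, ((Fintype.card ι : ℝ) / fiberCard β (B i) * blockWeight β A i (B i)) =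
      (∏ b, ((Fintype.card ι : ℝ) / fiberCard β b) ^ fiberCard β b) * balancedWeight β A := by
    unfold balancedWeight
    rw [Finset.mul_sum]
    refine Finset.sum_congr rfl fun B hB => ?_
    rw [Finset.prod_mul_distrib,
      prod_fiberCard B fun b => (Fintype.card ι : ℝ) / fiberCard β b, (Finset.mem_filter.1 hB).2]
  unfold permanent
  rw [sum_perm_prod_comp β fun i b => (Fintype.card ι : ℝ) / fiberCard β b * blockWeight β A i b,
    h1, ← mul_assoc, ← Finset.prod_mul_distrib,
    Real.log_mul (Finset.prod_pos fun b _ => ?_).ne' (balancedWeight_pos hq).ne',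
    Real.log_prod fun b _ => ?_]
  · congr 1
    refine Finset.sum_congr rfl fun b _ => ?_
    have := hm' b
    rw [Real.log_mul (by positivity) (by positivity), Real.log_pow,
      Real.log_div (by positivity) (by positivity)]
  · have := hm' b
    positivity
  · have := hm' b
    positivity

/-- Bounds for the permanent of an almost doubly stochastic matrix (up to a scaling) which
is almost constant on the columns of each block. -/
lemma abs_log_permanent_le {A : ι → ι → ℝ} {β : ι → κ} {c ε δ τ : ℝ} [Nonempty ι]
    (hc : 0 < c) (hδ : 0 < δ) (hδ1 : δ < 1) (hτ : 0 < τ)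
    (hcA : ∀ i j, c ≤ A i j) (hA : ∀ i j j', β j = β j' → A i j ≤ Real.exp ε * A i j')
    (hrow : ∀ i, |(∑ j, A i j) / Fintype.card ι - 1| ≤ δ / 16)
    (hcol : ∀ j, (∑ i, A i j) / Fintype.card ι ≤ 1 + δ / 16)
    (hm : ∀ b, 2 * τ * Fintype.card ι ≤ c * fiberCard β b)
    (hexp : ∑ b, Real.exp (-(δ ^ 2 / 8) * fiberCard β b) ≤ 1 / 2) :
    |Real.log (permanent A) - Real.log (Fintype.card ι).factorial| ≤
      Fintype.card ι * (ε + δ + δ / τ) +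
        ((Fintype.card κ + 1) * (1 + Real.log (Fintype.card ι)) + Real.log 2) := by
  set n := Fintype.card ι with hn
  have hn0 : (0 : ℝ) < n := by exact_mod_cast Fintype.card_pos
  have hA0 : ∀ i j, 0 < A i j := fun i j => hc.trans_le (hcA i j)
  have hm0 : ∀ b, 0 < fiberCard β b := fun b => by
    have : 0 < c * (fiberCard β b : ℝ) := lt_of_lt_of_le (by positivity) (hm b)
    exact_mod_cast (mul_pos_iff_of_pos_left hc).1 this
  have hm0' : ∀ b, (0 : ℝ) < fiberCard β b := fun b => by exact_mod_cast hm0 b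
  have hq2 : ∀ i b, 2 * τ ≤ blockWeight β A i b := fun i b => by
    rw [blockWeight, le_div_iff₀ hn0]
    refine (hm b).trans ?_
    rw [mul_comm, fiberCard, ← nsmul_eq_mul]
    exact Finset.card_nsmul_le_sum _ _ _ fun j _ => hcA i j
  have hq : ∀ i b, 0 < blockWeight β A i b := fun i b => lt_of_lt_of_le (by positivity) (hq2 i b)
  set Q : ι → ι → ℝ := fun i j => (n : ℝ) / fiberCard β (β j) * blockWeight β A i (β j) with hQ
  have hQe : ∀ i j, Q i j = (∑ j' with β j' = β j, A i j') / fiberCard β (β j) := fun i j => by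
    simp only [hQ, blockWeight, ← hn]
    field_simp
  have hQ0 : ∀ i j, 0 < Q i j := fun i j => mul_pos (div_pos hn0 (hm0' _)) (hq _ _)
  have hAQ : ∀ i j, A i j ≤ Real.exp ε * Q i j := fun i j => by
    rw [hQe, ← mul_div_assoc, le_div_iff₀ (hm0' _), Finset.mul_sum, mul_comm, fiberCard,
      ← nsmul_eq_mul]
    exact Finset.card_nsmul_le_sum _ _ _ fun j' hj' =>
      hA i j j' (Finset.mem_filter.1 hj').2.symm
  have hQA : ∀ i j, Q i j ≤ Real.exp ε * A i j := fun i j => by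
    rw [hQe, div_le_iff₀ (hm0' _), mul_comm _ (fiberCard β (β j) : ℝ), fiberCard, ← nsmul_eq_mul]
    exact Finset.sum_le_card_nsmul _ _ _ fun j' hj' => hA i j' j (Finset.mem_filter.1 hj').2
  have hPA := permanent_pos hA0
  have hPQ := permanent_pos hQ0
  have hlog1 := Real.log_le_log hPA (permanent_le_exp_mul hA0 hAQ)
  have hlog2 := Real.log_le_log hPQ (permanent_le_exp_mul hQ0 hQA)
  rw [Real.log_mul (Real.exp_ne_zero _) (by positivity), Real.log_exp] at hlog1 hlog2
  have hblock := log_permanent_block β hq hm0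
  have hfac := sum_log_factorial_bounds β
  rw [← hn] at hblock hfac hlog1 hlog2
  have hS := balancedWeight_pos hq
  have hrow' : ∀ i, |∑ b, blockWeight β A i b - 1| ≤ δ / 16 := fun i => by
    rw [sum_blockWeight]
    exact hrow i
  have hup : Real.log (balancedWeight β A) ≤ n * δ := by
    have h1 : balancedWeight β A ≤ ∏ i, ∑ b, blockWeight β A i b :=
      sum_filter_fiberCard_le (fun i b => (hq i b).le) _
    have h2 : ∏ i, ∑ b, blockWeight β A i b ≤ ∏ _i : ι, Real.exp δ :=
      Finset.prod_le_prod (fun i _ => Finset.sum_nonneg fun b _ => (hq i b).le) fun i _ => by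
        linarith [(abs_le.1 (hrow' i)).2, Real.add_one_le_exp δ]
    have h3 := Real.log_le_log hS (h1.trans h2)
    rw [Finset.prod_const, Finset.card_univ, ← hn, Real.log_pow, Real.log_exp] at h3
    exact h3
  have hlow : -(n * (δ + δ / τ)) - Real.log 2 ≤ Real.log (balancedWeight β A) := by
    set R : ι → ℝ := fun i => ∑ b, blockWeight β A i b with hR
    have hRl : ∀ i, 1 - δ / 16 ≤ R i := fun i => by linarith [(abs_le.1 (hrow' i)).1]
    have hRu : ∀ i, R i ≤ 1 + δ / 16 := fun i => by linarith [(abs_le.1 (hrow' i)).2]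
    have hR0 : ∀ i, 0 < R i := fun i => by linarith [hRl i]
    have h1 := half_le_sum_filter_fiberCard (w := fun i b => blockWeight β A i b / R i)
      (m := fiberCard β) hτ hδ hδ1 (fun i b => ?_) (fun i => ?_) (sum_fiberCard β) (fun b => ?_)
      hexp
    · have h2 : balancedWeight β A = ∑ B : ι → κ with fiberCard B = fiberCard β,
          (∏ i, R i) * ∏ i, blockWeight β A i (B i) / R i := by
        refine Finset.sum_congr rfl fun B _ => ?_
        rw [← Finset.prod_mul_distrib]
        exact Finset.prod_congr rfl fun i _ => (mul_div_cancel₀ _ (hR0 i).ne').symm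
      rw [← Finset.mul_sum] at h2
      set S := ∑ B : ι → κ with fiberCard B = fiberCard β, ∏ i, blockWeight β A i (B i) / R i
      have hS0 : 0 < S := by
        by_contra hcon
        have : 0 ≤ (1 + δ / τ) ^ Fintype.card ι := by positivity
        nlinarith
      have hRp : Real.exp (-δ) ^ n ≤ ∏ i, R i := by
        have : Real.exp (-δ) ^ n = ∏ _i : ι, Real.exp (-δ) := by simp [hn]
        rw [this]
        refine Finset.prod_le_prod (fun _ _ => (Real.exp_pos _).le) fun i _ => ?_
        refine le_trans ?_ (hRl i)
        rw [Real.exp_neg, inv_le_comm₀ (Real.exp_pos _) (by linarith)]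
        refine le_trans ?_ (Real.add_one_le_exp δ)
        rw [inv_le_iff_one_le_mul₀ (by linarith)]
        nlinarith
      have h3 : (1 + δ / τ) ^ n ≤ Real.exp (δ / τ) ^ n := by
        gcongr
        linarith [Real.add_one_le_exp (δ / τ)]
      have h4 := Real.log_le_log (by norm_num) (h1.trans (mul_le_mul_of_nonneg_right h3 hS0.le))
      have h5 := Real.log_le_log (by positivity) (mul_le_mul_of_nonneg_right hRp hS0.le)
      rw [← h2, Real.log_mul (by positivity) hS0.ne', Real.log_pow, Real.log_exp] at h5
      rw [Real.log_mul (by positivity) hS0.ne', Real.log_pow, Real.log_exp, one_div,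
        Real.log_inv] at h4
      linarith
    · rw [le_div_iff₀ (hR0 i)]
      refine le_trans ?_ (hq2 i b)
      nlinarith [hRu i]
    · rw [← Finset.sum_div, div_self (hR0 i).ne']
    · have h2 : ∑ i, blockWeight β A i b ≤ (1 + δ / 16) * fiberCard β b := by
        unfold blockWeight
        rw [← Finset.sum_div, Finset.sum_comm, Finset.sum_div, mul_comm, fiberCard,
          ← nsmul_eq_mul]
        exact Finset.sum_le_card_nsmul _ _ _ fun j _ => hcol j
      have h3 : ∑ i, blockWeight β A i b / R i ≤ (∑ i, blockWeight β A i b) / (1 - δ / 16) := by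
        rw [Finset.sum_div]
        exact Finset.sum_le_sum fun i _ =>
          div_le_div_of_nonneg_left (hq i b).le (by linarith) (hRl i)
      refine h3.trans ?_
      rw [div_le_iff₀ (by linarith)]
      refine h2.trans ?_
      rw [mul_right_comm]
      refine mul_le_mul_of_nonneg_right ?_ (Nat.cast_nonneg _)
      nlinarith
  rw [abs_le]
  have hlogn : 0 ≤ Real.log n := Real.log_natCast_nonneg n
  have hlog2' : 0 < Real.log 2 := Real.log_pos one_lt_two
  have hκ : (0 : ℝ) ≤ Fintype.card κ := Nat.cast_nonneg _
  have hδτ : 0 < n * (δ / τ) := by positivity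
  constructor <;> nlinarith [hfac.1, hfac.2, mul_nonneg hκ hlogn]

end BlockAverages

lemma grid_mem_Icc {n : ℕ} (i : Fin n) : ((i : ℝ) + 1) / n ∈ Set.Icc (0 : ℝ) 1 := by
  refine ⟨by positivity, div_le_one_of_le₀ ?_ (Nat.cast_nonneg n)⟩
  exact_mod_cast i.2

lemma abs_riemannSum_sub_le {h : ℝ → ℝ} (hh : Continuous h) {n : ℕ} (hn : 0 < n) {ε : ℝ}
    (hε : ∀ x ∈ Set.Icc (0 : ℝ) 1, ∀ y ∈ Set.Icc (0 : ℝ) 1, |x - y| ≤ 1 / n → |h x - h y| ≤ ε) :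
    |(∑ i : Fin n, h (((i : ℝ) + 1) / n)) / n - ∫ x in (0 : ℝ)..1, h x| ≤ ε := by
  have hn' : (0 : ℝ) < n := by exact_mod_cast hn
  have hint : ∫ x in (0 : ℝ)..1, h x =
      ∑ i ∈ Finset.range n, ∫ x in (i : ℝ) / n..((i : ℝ) + 1) / n, h x := by
    have := intervalIntegral.sum_integral_adjacent_intervals (f := h) (μ := volume)
      (a := fun i : ℕ => (i : ℝ) / n) (n := n) fun i _ => hh.intervalIntegrable _ _
    simp only [Nat.cast_add, Nat.cast_one] at this
    rw [this]
    simp [hn'.ne']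
  have hpiece : ∀ i ∈ Finset.range n,
      |h (((i : ℝ) + 1) / n) / n - ∫ x in (i : ℝ) / n..((i : ℝ) + 1) / n, h x| ≤ ε / n := by
    intro i hi
    have hlen : ((i : ℝ) + 1) / n - i / n = 1 / n := by ring
    have hle : (i : ℝ) / n ≤ ((i : ℝ) + 1) / n := by gcongr; linarith
    have h1 : ((i : ℝ) + 1) / n ∈ Set.Icc (0 : ℝ) 1 := grid_mem_Icc ⟨i, Finset.mem_range.1 hi⟩
    have h2 : h (((i : ℝ) + 1) / n) / n =
        ∫ _x in (i : ℝ) / n..((i : ℝ) + 1) / n, h (((i : ℝ) + 1) / n) := by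
      rw [intervalIntegral.integral_const, hlen, smul_eq_mul]
      ring
    rw [h2, ← intervalIntegral.integral_sub (by simp) (hh.intervalIntegrable _ _),
      ← Real.norm_eq_abs]
    refine (intervalIntegral.norm_integral_le_of_norm_le_const (C := ε) fun x hx => ?_).trans ?_
    · rw [Set.uIoc_of_le hle] at hx
      have h0 : (0 : ℝ) ≤ i / n := by positivity
      refine hε _ h1 _ ⟨h0.trans hx.1.le, hx.2.trans h1.2⟩ ?_
      rw [abs_of_nonneg (sub_nonneg.2 hx.2)]
      linarith [hx.1]
    · rw [hlen, abs_of_pos (by positivity)]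
      exact le_of_eq (by ring)
  rw [hint, Fin.sum_univ_eq_sum_range (fun i => h (((i : ℝ) + 1) / n)), Finset.sum_div,
    ← Finset.sum_sub_distrib]
  refine (Finset.abs_sum_le_sum_abs _ _).trans ((Finset.sum_le_sum hpiece).trans ?_)
  rw [Finset.sum_const, Finset.card_range, nsmul_eq_mul, mul_div_cancel₀ _ hn'.ne']

lemma tendsto_riemannSum {h : ℝ → ℝ} (hh : Continuous h) :
    Tendsto (fun n : ℕ => (∑ i : Fin n, h (((i : ℝ) + 1) / n)) / n) atTop
      (𝓝 (∫ x in (0 : ℝ)..1, h x)) := by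
  rw [Metric.tendsto_atTop']
  intro ε hε
  obtain ⟨r, hr, hu⟩ := Metric.uniformContinuousOn_iff.1
    (isCompact_Icc.uniformContinuousOn_of_continuous (hh.continuousOn (s := Set.Icc (0 : ℝ) 1)))
    (ε / 2) (by positivity)
  obtain ⟨N, hN⟩ := exists_nat_one_div_lt hr
  refine ⟨N, fun n hn => ?_⟩
  refine lt_of_le_of_lt (abs_riemannSum_sub_le hh (by omega) (ε := ε / 2)
    fun x hx y hy hxy => (hu x hx y hy (hxy.trans_lt ?_)).le) (by linarith)
  refine lt_of_le_of_lt (one_div_le_one_div_of_le (by positivity) ?_) hN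
  exact_mod_cast hn

/-- The partition of `Fin n` into `k` intervals of almost equal lengths. -/
def intervalBlock {n k : ℕ} (hk : 0 < k) (j : Fin n) : Fin k :=
  ⟨j * k / n, (Nat.div_lt_iff_lt_mul (Nat.zero_lt_of_lt j.2)).2 <| by
    rw [mul_comm k]; exact Nat.mul_lt_mul_of_pos_right j.2 hk⟩

lemma le_fiberCard_intervalBlock {n k : ℕ} (hk : 0 < k) (b : Fin k) :
    n / k ≤ fiberCard (intervalBlock (n := n) hk) b := by
  have hbound : ∀ t : Fin (n / k), b * n ≤ ((b * n + (k - 1)) / k + t) * k ∧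
      ((b * n + (k - 1)) / k + t) * k < (b + 1) * n := by
    intro t
    have h1 := Nat.div_add_mod (b * n + (k - 1)) k
    have h2 := Nat.mod_lt (b * n + (k - 1)) hk
    have h3 : (t + 1) * k ≤ n := (Nat.mul_le_mul_right k t.2).trans (Nat.div_mul_le_self n k)
    rw [mul_comm] at h1
    constructor
    · rw [add_mul]
      omega
    · rw [add_mul, add_mul]
      rw [add_mul] at h3
      omega
  have hlt : ∀ t : Fin (n / k), (b * n + (k - 1)) / k + t < n := fun t => by
    have h1 : (b + 1) * n ≤ k * n := Nat.mul_le_mul_right n b.2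
    exact Nat.lt_of_mul_lt_mul_right (((hbound t).2.trans_le h1).trans_eq (mul_comm _ _))
  let e : Fin (n / k) → Fin n := fun t => ⟨(b * n + (k - 1)) / k + t, hlt t⟩
  have he : Function.Injective e := fun s t hst => by
    have := Fin.val_eq_of_eq hst
    ext
    simpa [e] using this
  calc n / k = (Finset.univ.map ⟨e, he⟩).card := by simp
    _ ≤ _ := Finset.card_le_card fun j hj => by
      obtain ⟨t, -, rfl⟩ := Finset.mem_map.1 hj
      refine Finset.mem_filter.2 ⟨Finset.mem_univ _, Fin.ext ?_⟩
      exact Nat.div_eq_of_lt_le (hbound t).1 (hbound t).2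

lemma abs_sub_lt_of_intervalBlock_eq {n k : ℕ} (hk : 0 < k) {j j' : Fin n}
    (h : intervalBlock hk j = intervalBlock hk j') :
    |((j : ℝ) + 1) / n - ((j' : ℝ) + 1) / n| < 1 / k := by
  have hn : 0 < n := Nat.zero_lt_of_lt j.2
  have h1 : (j : ℕ) * k / n = j' * k / n := Fin.val_eq_of_eq h
  have key : ∀ {i i' : Fin n}, (i : ℕ) * k / n = i' * k / n → (i : ℝ) * k < i' * k + n := by
    intro i i' hi
    have h2 := Nat.div_add_mod (i * k) n
    have h3 := Nat.mod_lt (i * k) hn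
    have h4 := Nat.div_add_mod (i' * k) n
    rw [hi] at h2
    have : (i : ℕ) * k < i' * k + n := by omega
    exact_mod_cast this
  have hn' : (0 : ℝ) < n := by exact_mod_cast hn
  have hk' : (0 : ℝ) < k := by exact_mod_cast hk
  have e : ((j : ℝ) + 1) / n - ((j' : ℝ) + 1) / n = ((j : ℝ) - j') / n := by ring
  rw [e, abs_div, abs_of_pos hn', div_lt_div_iff₀ hn' hk', one_mul,
    ← abs_of_pos hk', ← abs_mul, abs_lt]
  constructor <;> linarith [key h1, key h1.symm]

/-- The permanents of the discretizations of a positive kernel with uniform marginals. -/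
lemma tendsto_log_permanent {G : ℝ × ℝ → ℝ} (hG : Continuous G)
    (hrow : ∀ x, ∫ y in (0 : ℝ)..1, Real.exp (G (x, y)) = 1)
    (hcol : ∀ y, ∫ x in (0 : ℝ)..1, Real.exp (G (x, y)) = 1) :
    Tendsto (fun n : ℕ => (Real.log (permanent fun i j : Fin n =>
      Real.exp (G (((i : ℝ) + 1) / n, ((j : ℝ) + 1) / n))) - Real.log n.factorial) / n)
      atTop (𝓝 0) := by
  obtain ⟨M, hM⟩ := isCompact_unitSq.exists_bound_of_continuousOn hG.continuousOn
  have hGu := Metric.uniformContinuousOn_iff.1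
    (isCompact_unitSq.uniformContinuousOn_of_continuous hG.continuousOn)
  have hEu := Metric.uniformContinuousOn_iff.1
    (isCompact_unitSq.uniformContinuousOn_of_continuous (Real.continuous_exp.comp hG).continuousOn)
  set c := Real.exp (-M) with hc
  have hc0 : 0 < c := Real.exp_pos _
  rw [Metric.tendsto_nhds]
  intro ε' hε'
  set ε := ε' / 5 with hε
  have hε0 : 0 < ε := by positivity
  obtain ⟨r, hr, hGr⟩ := hGu ε hε0
  obtain ⟨K, hK⟩ := exists_nat_one_div_lt hr
  set k := K + 1 with hk
  have hk0 : 0 < k := Nat.succ_pos K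
  have hk0' : (0 : ℝ) < k := by exact_mod_cast hk0
  have hkr : (1 : ℝ) / k < r := by simpa [hk] using hK
  set τ := c / (4 * k) with hτ
  have hτ0 : 0 < τ := by positivity
  set δ := min (1 / 2) (min ε (ε * τ)) with hδ
  have hδ0 : 0 < δ := lt_min (by norm_num) (lt_min hε0 (by positivity))
  have hδ1 : δ < 1 := lt_of_le_of_lt (min_le_left _ _) (by norm_num)
  have hδε : δ ≤ ε := (min_le_right _ _).trans (min_le_left _ _)
  have hδτ : δ / τ ≤ ε := (div_le_iff₀ hτ0).2 ((min_le_right _ _).trans (min_le_right _ _))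
  obtain ⟨s, hs, hEs⟩ := hEu (δ / 16) (by positivity)
  have hev1 : ∀ᶠ n : ℕ in atTop, (1 : ℝ) / n < s :=
    (tendsto_const_div_atTop_nhds_zero_nat 1).eventually (gt_mem_nhds hs)
  have hev2 : ∀ᶠ n : ℕ in atTop,
      (k : ℝ) * Real.exp (-(δ ^ 2 / 8) * ((n : ℝ) / (2 * k))) < 1 / 2 := by
    have h1 : Tendsto (fun n : ℕ => (δ ^ 2 / 8) * ((n : ℝ) / (2 * k))) atTop atTop :=
      (tendsto_natCast_atTop_atTop.atTop_div_const (by positivity)).const_mul_atTop (by positivity)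
    have h2 := (Real.tendsto_exp_neg_atTop_nhds_zero.comp h1).const_mul (k : ℝ)
    rw [mul_zero] at h2
    have := h2.eventually (gt_mem_nhds (show (0 : ℝ) < 1 / 2 by norm_num))
    simpa [Function.comp_def] using this
  have hev3 : ∀ᶠ n : ℕ in atTop,
      (((k : ℝ) + 1) * (1 + Real.log n) + Real.log 2) / n < ε := by
    have h1 : Tendsto (fun n : ℕ => Real.log n / n) atTop (𝓝 0) :=
      (Real.isLittleO_log_id_atTop.tendsto_div_nhds_zero).comp tendsto_natCast_atTop_atTop
    have h2 := ((tendsto_const_div_atTop_nhds_zero_nat ((k : ℝ) + 1)).add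
      (h1.const_mul ((k : ℝ) + 1))).add (tendsto_const_div_atTop_nhds_zero_nat (Real.log 2))
    simp only [mul_zero, add_zero] at h2
    filter_upwards [h2.eventually (gt_mem_nhds hε0)] with n hn
    refine lt_of_eq_of_lt ?_ hn
    ring
  filter_upwards [hev1, hev2, hev3, eventually_ge_atTop (2 * k)] with n hn1 hn2 hn3 hn4
  have hn : 0 < n := by omega
  have hn' : (0 : ℝ) < n := by exact_mod_cast hn
  have : Nonempty (Fin n) := ⟨⟨0, hn⟩⟩
  have hfib : ∀ b, (n : ℝ) / (2 * k) ≤ fiberCard (intervalBlock (n := n) hk0) b := by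
    intro b
    have h1 : ((n / k : ℕ) : ℝ) ≤ fiberCard (intervalBlock (n := n) hk0) b := by
      exact_mod_cast le_fiberCard_intervalBlock hk0 b
    have h2 : n < n / k * k + k := by
      have := Nat.div_add_mod n k
      have h3 := Nat.mod_lt n hk0
      rw [mul_comm] at this
      omega
    have h3 : (n : ℝ) < (n / k : ℕ) * k + k := by exact_mod_cast h2
    have h4 : (2 : ℝ) * k ≤ n := by exact_mod_cast hn4
    refine le_trans ?_ h1
    rw [div_le_iff₀ (by positivity)]
    linarith
  have hmem : ∀ i j : Fin n, (((i : ℝ) + 1) / n, ((j : ℝ) + 1) / n) ∈ unitSq :=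
    fun i j => ⟨grid_mem_Icc i, grid_mem_Icc j⟩
  have hmain := abs_log_permanent_le (ι := Fin n) (κ := Fin k) (c := c) (ε := ε) (δ := δ) (τ := τ)
    (A := fun i j => Real.exp (G (((i : ℝ) + 1) / n, ((j : ℝ) + 1) / n)))
    (β := intervalBlock hk0) hc0 hδ0 hδ1 hτ0 ?_ ?_ ?_ ?_ ?_ ?_
  · rw [Real.dist_eq, sub_zero, abs_div, abs_of_pos hn', div_lt_iff₀ hn']
    simp only [Fintype.card_fin] at hmain
    rw [div_lt_iff₀ hn'] at hn3
    have h1 : (n : ℝ) * (ε + δ + δ / τ) ≤ n * (3 * ε) :=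
      mul_le_mul_of_nonneg_left (by linarith) hn'.le
    have h2 : ε' = 5 * ε := by rw [hε]; ring
    have h3 := mul_pos hn' hε0
    rw [h2]
    linarith
  · intro i j
    exact Real.exp_le_exp.2 (abs_le.1 (hM _ (hmem i j))).1
  · intro i j j' hj
    rw [← Real.exp_add]
    refine Real.exp_le_exp.2 ?_
    have h1 := hGr _ (hmem i j) _ (hmem i j') <| by
      rw [Prod.dist_eq, dist_self, Real.dist_eq]
      exact max_lt hr ((abs_sub_lt_of_intervalBlock_eq hk0 hj).trans hkr)
    rw [Real.dist_eq] at h1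
    linarith [(abs_lt.1 h1).2]
  · intro i
    have h1 := abs_riemannSum_sub_le (h := fun y => Real.exp (G (((i : ℝ) + 1) / n, y)))
      (by fun_prop) hn (ε := δ / 16) fun x hx y hy hxy => ?_
    · rw [hrow] at h1
      rw [Fintype.card_fin]
      exact h1
    · refine (hEs (_, x) ⟨grid_mem_Icc i, hx⟩ (_, y) ⟨grid_mem_Icc i, hy⟩ ?_).le
      rw [Prod.dist_eq, dist_self, Real.dist_eq]
      exact max_lt hs (hxy.trans_lt hn1)
  · intro j
    have h1 := abs_riemannSum_sub_le (h := fun x => Real.exp (G (x, ((j : ℝ) + 1) / n)))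
      (by fun_prop) hn (ε := δ / 16) fun x hx y hy hxy => ?_
    · rw [hcol] at h1
      rw [Fintype.card_fin]
      linarith [(abs_le.1 h1).2]
    · refine (hEs (x, _) ⟨hx, grid_mem_Icc j⟩ (y, _) ⟨hy, grid_mem_Icc j⟩ ?_).le
      rw [Prod.dist_eq, dist_self, Real.dist_eq]
      exact max_lt (hxy.trans_lt hn1) hs
  · intro b
    rw [Fintype.card_fin]
    refine le_trans (le_of_eq ?_) (mul_le_mul_of_nonneg_left (hfib b) hc0.le)
    rw [hτ]
    field_simp
    ring
  · refine le_trans (Finset.sum_le_sum fun b _ => Real.exp_le_exp.2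
      (mul_le_mul_of_nonpos_left (hfib b) (by nlinarith [sq_nonneg δ]))) ?_
    rw [Finset.sum_const, Finset.card_univ, Fintype.card_fin, nsmul_eq_mul]
    exact hn2.le

/-- The limit of the normalized log normalizing constants. -/
lemma tendsto_Zn {f F : ℝ × ℝ → ℝ} (hF : Continuous F) (hfF : Set.EqOn f F unitSq) {θ : ℝ}
    {a b : ℝ → ℝ} (h : IsPotential (fun p => θ * F p) a b) :
    Tendsto (fun n : ℕ => (Zn f θ n - Real.log n.factorial) / n) atTop (𝓝 (dualVal a b)) := by
  have ha := h.left
  have hb := h.right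
  let G : ℝ × ℝ → ℝ := fun p => θ * F p + a p.1 + b p.2
  have hZ : ∀ n : ℕ, Zn f θ n = Real.log (permanent fun i j : Fin n =>
      Real.exp (G (((i : ℝ) + 1) / n, ((j : ℝ) + 1) / n))) -
        ∑ i : Fin n, a (((i : ℝ) + 1) / n) - ∑ i : Fin n, b (((i : ℝ) + 1) / n) := by
    intro n
    have h1 : ∀ π : Equiv.Perm (Fin n), Real.exp (θ * permStat f n π) =
        Real.exp (-(∑ i : Fin n, a (((i : ℝ) + 1) / n)) - ∑ i : Fin n, b (((i : ℝ) + 1) / n)) *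
          ∏ i : Fin n, Real.exp (G (((i : ℝ) + 1) / n, ((π i : ℝ) + 1) / n)) := by
      intro π
      rw [← Real.exp_sum, ← Real.exp_add]
      congr 1
      have h2 := Equiv.sum_comp π fun i : Fin n => b (((i : ℝ) + 1) / n)
      simp only [G, Finset.sum_add_distrib]
      rw [h2, ← Finset.mul_sum, permStat, Finset.sum_congr rfl fun i _ =>
        hfF (show _ ∈ unitSq from ⟨grid_mem_Icc i, grid_mem_Icc (π i)⟩)]
      ring
    have h3 := permanent_pos (A := fun i j : Fin n =>
      Real.exp (G (((i : ℝ) + 1) / n, ((j : ℝ) + 1) / n))) fun _ _ => Real.exp_pos _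
    unfold permanent at h3 ⊢
    unfold Zn
    rw [Finset.sum_congr rfl fun π _ => h1 π, ← Finset.mul_sum,
      Real.log_mul (Real.exp_ne_zero _) h3.ne', Real.log_exp]
    ring
  have h3 := ((tendsto_log_permanent (G := G) (by fun_prop) h.row h.col).sub
    (tendsto_riemannSum ha)).sub (tendsto_riemannSum hb)
  rw [zero_sub] at h3
  refine h3.congr fun n => ?_
  rw [hZ]
  ring

/-- A function continuous on the unit square has a bounded continuous extension. -/
lemma exists_bounded_extension {f : ℝ × ℝ → ℝ} (hf : ContinuousOn f unitSq) :
    ∃ F : ℝ × ℝ → ℝ, Continuous F ∧ Set.EqOn f F unitSq ∧ ∃ M, ∀ p, |F p| ≤ M := by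
  let P : ℝ × ℝ → ℝ × ℝ := fun p =>
    ((Set.projIcc 0 1 zero_le_one p.1 : ℝ), (Set.projIcc 0 1 zero_le_one p.2 : ℝ))
  have hP : Continuous P := by
    have : Continuous fun x : ℝ => ((Set.projIcc 0 1 zero_le_one x : Set.Icc (0 : ℝ) 1) : ℝ) :=
      continuous_subtype_val.comp continuous_projIcc
    exact (this.comp continuous_fst).prodMk (this.comp continuous_snd)
  have hmem : ∀ p, P p ∈ unitSq := fun p => ⟨Subtype.coe_prop _, Subtype.coe_prop _⟩
  obtain ⟨M, hM⟩ := isCompact_unitSq.exists_bound_of_continuousOn hf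
  refine ⟨f ∘ P, hf.comp_continuous hP hmem, fun p hp => ?_, M, fun p => hM _ (hmem p)⟩
  have : P p = p := by
    ext
    · simp [P, Set.projIcc_of_mem zero_le_one hp.1]
    · simp [P, Set.projIcc_of_mem zero_le_one hp.2]
  rw [Function.comp_apply, this]

lemma iSup_objE {f F : ℝ × ℝ → ℝ} (hF : Continuous F) (hfF : Set.EqOn f F unitSq) {θ : ℝ}
    {a b : ℝ → ℝ} (h : IsPotential (fun p => θ * F p) a b) :
    (⨆ μ ∈ MM, objE f θ μ) = (dualVal a b : EReal) := by
  refine le_antisymm (iSup₂_le fun μ hμ => ?_) ?_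
  · have h1 := objE_le_dual hF hfF h.left h.right θ hμ
    rwa [h.integral_exp (by fun_prop), add_sub_cancel_right] at h1
  · have h1 : objE f θ (gibbs (fun p => θ * F p) a b) = (dualVal a b : EReal) :=
      h.objE_gibbs hF hfF
    rw [← h1]
    exact le_iSup₂ (f := fun μ (_ : μ ∈ MM) => objE f θ μ) _ (h.gibbs_mem_MM (by fun_prop))

/-- The objective of a fixed measure is affine in the parameter. -/
lemma add_mul_integral_le {f : ℝ × ℝ → ℝ} {θ t v w : ℝ} {μ : Measure (ℝ × ℝ)}
    (hθ : objE f θ μ = (v : EReal)) (ht : objE f t μ ≤ (w : EReal)) :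
    v + (t - θ) * ∫ p, f p ∂μ ≤ w := by
  unfold objE at hθ ht
  cases hK : KL μ usq with
  | top => simp [hK] at hθ
  | coe x =>
    have e : ((x : ℝ≥0∞) : EReal) = ((x : ℝ) : EReal) := rfl
    rw [hK, e, ← EReal.coe_sub] at hθ ht
    rw [EReal.coe_eq_coe_iff] at hθ
    rw [EReal.coe_le_coe_iff] at ht
    linarith

/-- For `f ∈ 𝓒`, the limiting log normalizing constant `θ ↦ Z(f,θ)` is
convex and differentiable, with derivative `Z'(f,θ) = μ_{f,θ}[f] = lim (1/n) Z_n'(f,θ)`,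
and the derivative is continuous and strictly increasing. -/
theorem Z_convex_differentiable (f : ℝ × ℝ → ℝ) (hf : memC f)
    (Zlim : ℝ → ℝ) (hZlim : ∀ θ : ℝ, (⨆ μ ∈ MM, objE f θ μ) = (Zlim θ : EReal))
    (μf : ℝ → Measure (ℝ × ℝ))
    (hμf : ∀ θ : ℝ, μf θ ∈ MM ∧ ∀ ν ∈ MM, objE f θ ν ≤ objE f θ (μf θ)) :
    ConvexOn ℝ Set.univ Zlim ∧
    (∀ θ : ℝ, HasDerivAt Zlim (∫ p, f p ∂(μf θ)) θ) ∧
    (∀ θ : ℝ, Tendsto (fun n : ℕ => deriv (fun t => Zn f t n) θ / n) atTop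
      (𝓝 (∫ p, f p ∂(μf θ)))) ∧
    Continuous (fun θ : ℝ => ∫ p, f p ∂(μf θ)) ∧
    StrictMono (fun θ : ℝ => ∫ p, f p ∂(μf θ)) := by
  obtain ⟨hcont, hne, hrow, hcol⟩ := hf
  obtain ⟨F, hF, hfF, M, hM⟩ := exists_bounded_extension hcont
  have hM0 : 0 ≤ M := (abs_nonneg _).trans (hM 0)
  have hpot : ∀ θ : ℝ, ∃ ab : (ℝ → ℝ) × (ℝ → ℝ),
      IsPotential (fun p => θ * F p) ab.1 ab.2 := fun θ => by
    obtain ⟨a, b, ha, hb, h1, h2⟩ := exists_schrodinger_potentials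
      (F := fun p => θ * F p) (by fun_prop) (M := |θ| * M) fun p => by
        rw [abs_mul]
        exact mul_le_mul_of_nonneg_left (hM p) (abs_nonneg θ)
    exact ⟨(a, b), ha, hb, h1, h2⟩
  choose ab hab using hpot
  have hZ : ∀ θ, Zlim θ = dualVal (ab θ).1 (ab θ).2 := fun θ => by
    have := hZlim θ
    rw [iSup_objE hF hfF (hab θ), EReal.coe_eq_coe_iff] at this
    exact this.symm
  have hFrow : ∀ x ∈ Set.Icc (0 : ℝ) 1, (∫ z in (0 : ℝ)..1, F (x, z)) = 0 := fun x hx => by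
    refine Eq.trans (intervalIntegral.integral_congr fun z hz => ?_) (hrow x hx)
    rw [Set.uIcc_of_le zero_le_one] at hz
    exact (hfF ⟨hx, hz⟩).symm
  have hFcol : ∀ y ∈ Set.Icc (0 : ℝ) 1, (∫ z in (0 : ℝ)..1, F (z, y)) = 0 := fun y hy => by
    refine Eq.trans (intervalIntegral.integral_congr fun z hz => ?_) (hcol y hy)
    rw [Set.uIcc_of_le zero_le_one] at hz
    exact (hfF ⟨hz, hy⟩).symm
  have hFne : ∃ p ∈ unitSq, F p ≠ 0 := by
    obtain ⟨p, hp, hfp⟩ := hne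
    exact ⟨p, hp, hfF hp ▸ hfp⟩
  set c : ℝ → ℝ := fun θ => gibbsMean F θ (ab θ).1 (ab θ).2
  have hlt : ∀ θ t, θ ≠ t → Zlim θ + (t - θ) * c θ < Zlim t := fun θ t hθ => by
    rw [hZ, hZ]
    exact dualVal_lt hF hFrow hFcol hFne hθ (hab θ) (hab t)
  have hsub : ∀ θ t, Zlim θ + (t - θ) * c θ ≤ Zlim t := fun θ t => by
    rcases eq_or_ne θ t with rfl | h
    · simp
    · exact (hlt θ t h).le
  have hr : 0 < 1 / (M + 1) := by positivity
  have hup : ∀ θ s, |s| ≤ 1 / (M + 1) → Zlim (θ + s) ≤ Zlim θ + s * c θ + M ^ 2 * s ^ 2 :=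
    fun θ s hs => by
      rw [hZ, hZ]
      refine dualVal_add_le hF hM ?_ (hab θ) (hab (θ + s))
      rw [le_div_iff₀ (by positivity)] at hs
      linarith [abs_nonneg s]
  have hderiv := hasDerivAt_of_subgradient hsub hr hup
  have hmean : ∀ θ, ∫ p, f p ∂(μf θ) = c θ := fun θ => by
    refine eq_of_subgradient_of_hasDerivAt (V := Zlim) (fun t => ?_) (hderiv θ)
    refine add_mul_integral_le ?_ ?_
    · rw [← hZlim]
      exact le_antisymm (le_iSup₂ (f := fun μ (_ : μ ∈ MM) => objE f θ μ) _ (hμf θ).1)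
        (iSup₂_le (hμf θ).2)
    · rw [← hZlim]
      exact le_iSup₂ (f := fun μ (_ : μ ∈ MM) => objE f t μ) _ (hμf θ).1
  simp only [hmean]
  refine ⟨convexOn_of_subgradient hsub, hderiv, fun θ => ?_, continuous_of_subgradient hsub hr hup,
    strictMono_of_subgradient hlt⟩
  refine tendsto_subgradient (V := Zlim)
    (W := fun n t => (Zn f t n - Real.log n.factorial) / n)
    (D := fun n θ => deriv (fun t => Zn f t n) θ / n) (fun n t => ?_) (fun t => ?_) (hderiv θ)
  · rw [← mul_div_assoc, ← add_div]
    refine div_le_div_of_nonneg_right ?_ (Nat.cast_nonneg n)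
    linarith [Zn_subgradient f θ t n]
  · rw [hZ]
    exact tendsto_Zn hF hfF (hab t)
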